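/- Let v, w ∈ k^{r×n} and suppose there is a bijection σ of {1,…,n} such that for every S ⊆ {1,…,n}, the columns {v_j : j ∈ S} are linearly independent if and only if the columns {w_{σ(j)} : j ∈ S} are linearly independent (i.e. v and w have isomorphic matroids). Then there is a k-linear isomorphism Φ : G(v) → G(w) satisfying Φ(g·x) = g·Φ(x) for all g ∈ GL_r(k) and x ∈ G(v); that is, the isomorphism type of the cyclic GL_r(k)-module G(v) generated by the decomposable tensor v_1⊗⋯⊗v_n is a function of the unlabeled matroid of v. -/

import Mathlib

noncomputable section

open scoped TensorProduct

/-- The diagonal action of a matrix `g` on `(k^r)^{⊗n}`. -/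
def diagAct (k : Type*) [Field k] {r n : ℕ} (g : Matrix (Fin r) (Fin r) k) :
    (PiTensorProduct k fun _ : Fin n => Fin r → k) →ₗ[k]
      (PiTensorProduct k fun _ : Fin n => Fin r → k) :=
  PiTensorProduct.map fun _ => g.mulVecLin

/-- The decomposable tensor `v₁ ⊗ ⋯ ⊗ v_n` of the columns of `v`. -/
def vtens (k : Type*) [Field k] {r n : ℕ} (v : Matrix (Fin r) (Fin n) k) :
    PiTensorProduct k fun _ : Fin n => Fin r → k :=
  PiTensorProduct.tprod k fun j => fun i => v i j

/-- The tensor module `G(v)`: the cyclic `GL_r(k)`-module generated by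
`v₁ ⊗ ⋯ ⊗ v_n`, i.e. the span of its `GL_r(k)`-orbit. -/
def tensMod (k : Type*) [Field k] {r n : ℕ} (v : Matrix (Fin r) (Fin n) k) :
    Submodule k (PiTensorProduct k fun _ : Fin n => Fin r → k) :=
  Submodule.span k {x | ∃ g : (Matrix (Fin r) (Fin r) k)ˣ, x = diagAct k g.1 (vtens k v)}

section LinearForms

open MvPolynomial

attribute [local instance] MvPolynomial.gradedAlgebra

theorem exists_homogeneous_sub_mul_mem {ι k R : Type*} [DecidableEq ι] [AddCommMonoid ι]
    [IsCancelAdd ι] [CommSemiring k]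
    [CommRing R] [Algebra k R] (𝒜 : ι → Submodule k R) [GradedAlgebra 𝒜] {I : Ideal R}
    (hI : I.IsHomogeneous 𝒜) {e m : ι} {x f : R} (hx : x ∈ 𝒜 e) (hf : f ∈ 𝒜 (e + m))
    (h : f ∈ I ⊔ Ideal.span {x}) : ∃ g ∈ 𝒜 m, f - x * g ∈ I := by
  let : AddLeftCancelMonoid ι :=
    { (inferInstance : AddMonoid ι) with
      add_left_cancel := fun a _ _ h => add_left_cancel (a := a) h }
  obtain ⟨p, hp, q, hq, rfl⟩ := Submodule.mem_sup.1 h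
  obtain ⟨g, rfl⟩ := Ideal.mem_span_singleton'.1 hq
  refine ⟨DirectSum.decompose 𝒜 g m, SetLike.coe_mem _, ?_⟩
  have h1 := DirectSum.decompose_of_mem_same 𝒜 hf
  rw [DirectSum.decompose_add, DirectSum.add_apply, Submodule.coe_add, mul_comm g x,
    DirectSum.coe_decompose_mul_add_of_left_mem 𝒜 hx] at h1
  rw [mul_comm g x, ← h1, add_sub_cancel_right]
  exact hI _ hp

variable {k σ κ : Type*} [Field k]

theorem Subspace.exists_forall_notMem [Infinite k] {E ι : Type*} [AddCommGroup E] [Module k E]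
    (s : Finset ι) (U : ι → Submodule k E) :
    ∃ x, ∀ i ∈ s, U i ≠ ⊤ → x ∉ U i := by
  classical
  have := Subspace.biUnion_ne_univ_of_top_notMem (k := k) (E := E) (s := (s.image U).filter (· ≠ ⊤))
    (by simp)
  rw [Set.ne_univ_iff_exists_notMem] at this
  obtain ⟨x, hx⟩ := this
  refine ⟨x, fun i hi hU hxi => hx ?_⟩
  simp only [Set.mem_iUnion]
  exact ⟨U i, by simp [hU]; exact ⟨i, hi, rfl⟩, hxi⟩

variable [Fintype σ]

/-- The linear form in the variables `X s` with coefficient vector `y`. -/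
def linForm : (σ → k) →ₗ[k] MvPolynomial σ k := Fintype.linearCombination k X

theorem linForm_apply (y : σ → k) : linForm y = ∑ s, y s • (X s : MvPolynomial σ k) := rfl

theorem isHomogeneous_linForm (y : σ → k) : (linForm y).IsHomogeneous 1 := by
  rw [linForm_apply]
  exact (homogeneousSubmodule σ k 1).sum_mem fun s _ =>
    Submodule.smul_mem _ _ (isHomogeneous_X _ _)

/-- The ideal generated by a space of linear forms. -/
def linIdeal (V : Submodule k (σ → k)) : Ideal (MvPolynomial σ k) := Ideal.span (linForm '' V)

theorem linForm_mem_linIdeal {V : Submodule k (σ → k)} {y : σ → k} (hy : y ∈ V) :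
    linForm y ∈ linIdeal V := Ideal.subset_span ⟨y, hy, rfl⟩

theorem linIdeal_le_iff {V : Submodule k (σ → k)} {I : Ideal (MvPolynomial σ k)} :
    linIdeal V ≤ I ↔ ∀ y ∈ V, linForm y ∈ I := by
  rw [linIdeal, Ideal.span_le, Set.image_subset_iff]; rfl

theorem linIdeal_mono {V W : Submodule k (σ → k)} (h : V ≤ W) : linIdeal V ≤ linIdeal W :=
  linIdeal_le_iff.2 fun _ hy => linForm_mem_linIdeal (h hy)

theorem linIdeal_sup (V W : Submodule k (σ → k)) : linIdeal (V ⊔ W) = linIdeal V ⊔ linIdeal W := by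
  refine le_antisymm (linIdeal_le_iff.2 fun y hy => ?_)
    (sup_le (linIdeal_mono le_sup_left) (linIdeal_mono le_sup_right))
  obtain ⟨a, ha, b, hb, rfl⟩ := Submodule.mem_sup.1 hy
  rw [map_add]
  exact add_mem (Ideal.mem_sup_left (linForm_mem_linIdeal ha))
    (Ideal.mem_sup_right (linForm_mem_linIdeal hb))

theorem linIdeal_span_singleton (x : σ → k) : linIdeal (k ∙ x) = Ideal.span {linForm x} := by
  refine le_antisymm (linIdeal_le_iff.2 fun y hy => ?_) ?_
  · obtain ⟨c, rfl⟩ := Submodule.mem_span_singleton.1 hy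
    rw [map_smul, Algebra.smul_def]
    exact Ideal.mul_mem_left _ _ (Ideal.mem_span_singleton_self _)
  · rw [Ideal.span_singleton_le_iff_mem]
    exact linForm_mem_linIdeal (Submodule.mem_span_singleton_self x)

theorem isHomogeneous_linIdeal (V : Submodule k (σ → k)) :
    (linIdeal V).IsHomogeneous (homogeneousSubmodule σ k) := by
  refine Ideal.homogeneous_span _ _ ?_
  rintro _ ⟨y, -, rfl⟩
  exact ⟨1, isHomogeneous_linForm y⟩

theorem MvPolynomial.IsHomogeneous.mem_linIdeal_top {f : MvPolynomial σ k} {d : ℕ}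
    (hf : f.IsHomogeneous d) (hd : 0 < d) : f ∈ linIdeal (⊤ : Submodule k (σ → k)) := by
  classical
  rw [← f.support_sum_monomial_coeff]
  refine Ideal.sum_mem _ fun m hm => ?_
  have hm' := hf (mem_support_iff.1 hm)
  obtain ⟨s, hs⟩ : ∃ s, m s ≠ 0 := by
    by_contra! h
    have : m = 0 := Finsupp.ext h
    subst this
    simp at hm'; omega
  have hX : (X s : MvPolynomial σ k) ∈ linIdeal (⊤ : Submodule k (σ → k)) := by
    have : (X s : MvPolynomial σ k) = linForm (Pi.single s 1) := by
      simp [linForm_apply, Pi.single_apply]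
    rw [this]; exact linForm_mem_linIdeal trivial
  have : X s ∣ monomial m (coeff m f) := by
    rw [X_dvd_monomial]; right; exact hs
  exact Ideal.mem_of_dvd _ this hX

/-- The sum of the product of the ideals generated by the spaces `V j`, `j ∈ A`, and the ideal
generated by `Q`. -/
def prodIdeal (V : κ → Submodule k (σ → k)) (Q : Submodule k (σ → k)) (A : Finset κ) :
    Ideal (MvPolynomial σ k) := (∏ j ∈ A, linIdeal (V j)) ⊔ linIdeal Q

variable {V : κ → Submodule k (σ → k)} {Q : Submodule k (σ → k)} {A : Finset κ}

theorem Ideal.IsHomogeneous.finsetProd {ι R : Type*} [DecidableEq ι] [AddCommMonoid ι]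
    [CommRing R] [Algebra k R] (𝒜 : ι → Submodule k R) [GradedAlgebra 𝒜] (A : Finset κ)
    (I : κ → Ideal R) (h : ∀ j ∈ A, (I j).IsHomogeneous 𝒜) : (∏ j ∈ A, I j).IsHomogeneous 𝒜 := by
  classical
  induction A using Finset.induction_on with
  | empty => simpa using Ideal.IsHomogeneous.top 𝒜
  | insert j A hj ih =>
    rw [Finset.prod_insert hj]
    exact (h j (Finset.mem_insert_self _ _)).mul (ih fun i hi => h i (Finset.mem_insert_of_mem hi))

theorem isHomogeneous_prodIdeal : (prodIdeal V Q A).IsHomogeneous (homogeneousSubmodule σ k) :=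
  Ideal.IsHomogeneous.sup (Ideal.IsHomogeneous.finsetProd (homogeneousSubmodule σ k) A
    (fun j => linIdeal (V j)) fun j _ => isHomogeneous_linIdeal (V j)) (isHomogeneous_linIdeal Q)

theorem linIdeal_le_prodIdeal : linIdeal Q ≤ prodIdeal V Q A := le_sup_right

theorem prodIdeal_sup_span (x : σ → k) :
    prodIdeal V (Q ⊔ k ∙ x) A = prodIdeal V Q A ⊔ Ideal.span {linForm x} := by
  rw [prodIdeal, prodIdeal, linIdeal_sup, linIdeal_span_singleton, sup_assoc]

theorem prodIdeal_mono {Q' : Submodule k (σ → k)} (h : Q ≤ Q') :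
    prodIdeal V Q A ≤ prodIdeal V Q' A := sup_le_sup_left (linIdeal_mono h) _

theorem mul_mem_prodIdeal_insert [DecidableEq κ] {j : κ} (hj : j ∉ A) {y : σ → k} (hy : y ∈ V j)
    {f : MvPolynomial σ k} (hf : f ∈ prodIdeal V Q A) :
    linForm y * f ∈ prodIdeal V Q (insert j A) := by
  obtain ⟨a, ha, b, hb, rfl⟩ := Submodule.mem_sup.1 hf
  rw [mul_add]
  refine add_mem (Ideal.mem_sup_left ?_) (Ideal.mem_sup_right (Ideal.mul_mem_left _ _ hb))
  rw [Finset.prod_insert hj]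
  exact Ideal.mul_mem_mul (linForm_mem_linIdeal hy) ha

theorem prodIdeal_anti {B : Finset κ} (h : A ⊆ B) : prodIdeal V Q B ≤ prodIdeal V Q A := by
  classical
  refine sup_le_sup_right ?_ _
  rw [← Finset.prod_sdiff h]
  exact Ideal.mul_le_right

theorem prodIdeal_top {d : ℕ} {f : MvPolynomial σ k} (hf : f.IsHomogeneous d) (hd : A.card ≤ d) :
    f ∈ prodIdeal V ⊤ A := by
  rcases Nat.eq_zero_or_pos d with rfl | h
  · have : A = ∅ := by simpa using hd
    subst this
    simp [prodIdeal]
  · exact linIdeal_le_prodIdeal (hf.mem_linIdeal_top h)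

open Classical in
/-- Directional derivative along the vector with coordinates `θ`. -/
def dirDeriv (θ : (σ → k) →ₗ[k] k) :
    Derivation k (MvPolynomial σ k) (MvPolynomial σ k) :=
  mkDerivation k fun s => C (θ (Pi.single s 1))

theorem dirDeriv_apply (θ : (σ → k) →ₗ[k] k) [DecidableEq σ] (f : MvPolynomial σ k) :
    dirDeriv θ f = ∑ s, θ (Pi.single s 1) • pderiv (R := k) s f := by
  have hsum : ∀ g, (∑ s, θ (Pi.single s 1) • pderiv (R := k) s :
      Derivation k (MvPolynomial σ k) (MvPolynomial σ k)) g =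
      ∑ s, θ (Pi.single s 1) • pderiv (R := k) s g := fun g => by
    rw [show ∀ D : Derivation k (MvPolynomial σ k) (MvPolynomial σ k), D g =
      (Pi.evalAddMonoidHom _ g).comp Derivation.coeFnAddMonoidHom D from fun _ => rfl, map_sum]
    rfl
  rw [← hsum]
  congr 1
  refine MvPolynomial.derivation_ext fun s => ?_
  rw [dirDeriv, mkDerivation_X, hsum, Finset.sum_eq_single s]
  · rw [pderiv_X_self, MvPolynomial.smul_eq_C_mul, mul_one]
    congr!
  · intro b _ hb
    rw [pderiv_X_of_ne hb.symm, smul_zero]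
  · simp

theorem dirDeriv_linForm (θ : (σ → k) →ₗ[k] k) (y : σ → k) :
    dirDeriv θ (linForm y) = C (θ y) := by
  classical
  rw [linForm_apply, map_sum]
  simp only [Derivation.map_smul, dirDeriv, mkDerivation_X]
  conv_rhs => rw [← Finset.univ_sum_single y]
  rw [map_sum, map_sum]
  refine Finset.sum_congr rfl fun s _ => ?_
  rw [show Pi.single s (y s) = y s • (Pi.single s 1 : σ → k) by
    rw [← Pi.single_smul]; simp, map_smul, smul_eq_mul, C_mul, MvPolynomial.smul_eq_C_mul]

theorem MvPolynomial.IsHomogeneous.dirDeriv (θ : (σ → k) →ₗ[k] k) {f : MvPolynomial σ k} {d : ℕ}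
    (hf : f.IsHomogeneous (d + 1)) : (dirDeriv θ f).IsHomogeneous d := by
  classical
  rw [dirDeriv_apply]
  refine (homogeneousSubmodule σ k d).sum_mem fun s _ => ?_
  exact Submodule.smul_mem _ _ (by simpa using hf.pderiv)

theorem dirDeriv_mem_span {θ : (σ → k) →ₗ[k] k} {V : Submodule k (σ → k)}
    (hV : V ≤ LinearMap.ker θ) {f : MvPolynomial σ k} (hf : f ∈ linIdeal V) :
    dirDeriv θ f ∈ linIdeal V := by
  induction hf using Submodule.span_induction with
  | mem x hx =>
    obtain ⟨y, hy, rfl⟩ := hx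
    rw [dirDeriv_linForm, hV hy, C_0]; exact zero_mem _
  | zero => simp
  | add x y _ _ hx hy => rw [map_add]; exact add_mem hx hy
  | smul a x hx ih =>
    rw [smul_eq_mul, Derivation.leibniz, smul_eq_mul, smul_eq_mul]
    exact add_mem (Ideal.mul_mem_left _ _ ih) (Ideal.mul_mem_right _ _ hx)

theorem dirDeriv_mem_prodIdeal {θ : (σ → k) →ₗ[k] k} (hQ : Q ≤ LinearMap.ker θ)
    (hV : ∀ j ∈ A, V j ≤ LinearMap.ker θ) {f : MvPolynomial σ k} (hf : f ∈ prodIdeal V Q A) :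
    dirDeriv θ f ∈ prodIdeal V Q A := by
  classical
  obtain ⟨a, ha, b, hb, rfl⟩ := Submodule.mem_sup.1 hf
  rw [map_add]
  refine add_mem (Ideal.mem_sup_left ?_) (Ideal.mem_sup_right (dirDeriv_mem_span hQ hb))
  clear hf hb hQ
  induction A using Finset.induction_on generalizing a with
  | empty => simp
  | insert j A hj ih =>
    rw [Finset.prod_insert hj] at ha ⊢
    have ih := ih fun i hi => hV i (Finset.mem_insert_of_mem hi)
    have hj' := hV j (Finset.mem_insert_self _ _)
    induction ha using Submodule.mul_induction_on' with
    | mem_mul_mem m hm n hn =>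
      rw [Derivation.leibniz, smul_eq_mul, smul_eq_mul]
      refine add_mem (Ideal.mul_mem_mul hm (ih n hn)) ?_
      exact Ideal.mul_mem_mul_rev (dirDeriv_mem_span hj' hm) hn
    | add x _ y _ hx hy => rw [map_add]; exact add_mem hx hy

/-- A linear form outside the span of all the generators is a nonzerodivisor. -/
theorem mem_of_pow_mul_mem [CharZero k] {x : σ → k} (hx : x ∉ A.sup V ⊔ Q) (d : ℕ) :
    ∀ (p : ℕ) (f : MvPolynomial σ k), f.IsHomogeneous d → linForm x ^ p * f ∈ prodIdeal V Q A →
      f ∈ prodIdeal V Q A := by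
  obtain ⟨θ, hθx, hθ⟩ := Submodule.exists_le_ker_of_notMem hx
  have hstep : ∀ (p : ℕ) (f : MvPolynomial σ k), linForm x ^ (p + 1) * f ∈ prodIdeal V Q A →
      dirDeriv θ f ∈ prodIdeal V Q A → linForm x ^ p * f ∈ prodIdeal V Q A := by
    intro p f hf hdf
    have h1 := dirDeriv_mem_prodIdeal (le_sup_right.trans hθ)
      (fun j hj => ((Finset.le_sup hj).trans le_sup_left).trans hθ) hf
    rw [Derivation.leibniz, Derivation.leibniz_pow, dirDeriv_linForm, smul_eq_mul] at h1
    have h2 := (Submodule.add_mem_iff_right _ (Ideal.mul_mem_left _ (linForm x ^ (p + 1)) hdf)).1 h1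
    have h3 : f • (p + 1) • linForm x ^ (p + 1 - 1) • (C (θ x) : MvPolynomial σ k) =
      C ((p + 1 : ℕ) * θ x) * (linForm x ^ p * f) := by
      simp only [smul_eq_mul, nsmul_eq_mul, add_tsub_cancel_right, C_mul, map_natCast]
      ring
    rw [h3] at h2
    have h4 := Ideal.mul_mem_left _ (C (((p + 1 : ℕ) * θ x)⁻¹)) h2
    rwa [← mul_assoc, ← C_mul,
      inv_mul_cancel₀ (mul_ne_zero (Nat.cast_ne_zero.2 p.succ_ne_zero) hθx), C_1, one_mul] at h4
  have hdesc : ∀ (f : MvPolynomial σ k), dirDeriv θ f ∈ prodIdeal V Q A → ∀ p,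
      linForm x ^ p * f ∈ prodIdeal V Q A → f ∈ prodIdeal V Q A := by
    intro f hdf p
    induction p with
    | zero => intro h; simpa using h
    | succ p ih => exact fun h => ih (hstep p f h hdf)
  induction d with
  | zero =>
    intro p f hf h
    refine hdesc f ?_ p h
    obtain ⟨c, rfl⟩ : ∃ c, f = C c :=
      ⟨_, (totalDegree_eq_zero_iff_eq_C.1 (Nat.le_zero.1 hf.totalDegree_le))⟩
    simp
  | succ d ih =>
    intro p f hf h
    refine hdesc f (ih (p + 1) _ (hf.dirDeriv θ) ?_) p h
    have h1 := dirDeriv_mem_prodIdeal (le_sup_right.trans hθ)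
      (fun j hj => ((Finset.le_sup hj).trans le_sup_left).trans hθ) h
    rw [Derivation.leibniz, Derivation.leibniz_pow, dirDeriv_linForm, smul_eq_mul] at h1
    have h2 := Ideal.mul_mem_left _ (linForm x) h1
    rw [mul_add] at h2
    have h3 : linForm x * f • p • linForm x ^ (p - 1) • (C (θ x) : MvPolynomial σ k) ∈
        prodIdeal V Q A := by
      rcases p with _ | p
      · simp
      · have : linForm x * f • (p + 1) • linForm x ^ (p + 1 - 1) • (C (θ x) : MvPolynomial σ k) =
            (((p + 1 : ℕ) : MvPolynomial σ k) * C (θ x)) * (linForm x ^ (p + 1) * f) := by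
          simp only [smul_eq_mul, nsmul_eq_mul, add_tsub_cancel_right]
          ring
        rw [this]
        exact Ideal.mul_mem_left _ _ h
    have h4 := (Submodule.add_mem_iff_left _ h3).1 h2
    rwa [← mul_assoc, ← pow_succ'] at h4

theorem linForm_mul_mem_of_erase [DecidableEq κ] (hA : A.sup V ⊔ Q = ⊤) {g : MvPolynomial σ k}
    (hg : ∀ i ∈ A, g ∈ prodIdeal V Q (A.erase i)) (y : σ → k) :
    linForm y * g ∈ prodIdeal V Q A := by
  let T : Submodule k (σ → k) := ((prodIdeal V Q A).restrictScalars k).comap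
    ((LinearMap.mulRight k g).comp linForm)
  have hT : A.sup V ⊔ Q ≤ T := by
    refine sup_le (Finset.sup_le fun i hi z hz => ?_) fun z hz => ?_
    · have := mul_mem_prodIdeal_insert (Finset.notMem_erase i A) hz (hg i hi)
      rwa [Finset.insert_erase hi] at this
    · exact linIdeal_le_prodIdeal (Ideal.mul_mem_right _ _ (linForm_mem_linIdeal hz))
  rw [hA] at hT
  exact hT (Submodule.mem_top (x := y))

/-- In high enough degree, products of ideals of linear forms are saturated with respect to a
generic linear form. -/
theorem mem_of_linForm_mul_mem [CharZero k] (V : κ → Submodule k (σ → k))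
    (Q : Submodule k (σ → k)) (A : Finset κ) (x : σ → k)
    (hx : ∀ F ⊆ A, F.sup V ⊔ Q ≠ ⊤ → x ∉ F.sup V ⊔ Q) (d : ℕ) (f : MvPolynomial σ k)
    (hf : f.IsHomogeneous d) (hd : A.sup V ⊔ Q ≠ ⊤ ∨ A.card ≤ d)
    (h : linForm x * f ∈ prodIdeal V Q A) : f ∈ prodIdeal V Q A := by
  classical
  induction Q using WellFoundedGT.induction generalizing A x d f with
  | ind Q ihQ =>
  induction A using Finset.strongInduction generalizing d f with
  | H A ihA =>
  by_cases hA : A.sup V ⊔ Q = ⊤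
  swap
  · exact mem_of_pow_mul_mem (hx A subset_rfl hA) d 1 f hf (by simpa using h)
  have hcd : A.card ≤ d := hd.resolve_left (not_not.2 hA)
  by_cases hQ : Q = ⊤
  · subst hQ; exact prodIdeal_top hf hcd
  have hxQ : x ∉ Q := by simpa using hx ∅ (Finset.empty_subset A) (by simpa using hQ)
  have hA0 : A.Nonempty := by
    rw [Finset.nonempty_iff_ne_empty]
    rintro rfl
    exact hQ (by simpa using hA)
  have hcard : 0 < A.card := hA0.card_pos
  have key : ∀ (g : MvPolynomial σ k) (e : ℕ), g.IsHomogeneous e → A.card ≤ e + 1 →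
      (∀ i ∈ A, linForm x * g ∈ prodIdeal V Q (A.erase i)) →
      ∀ i ∈ A, g ∈ prodIdeal V Q (A.erase i) := fun g e hg he h i hi =>
    ihA _ (Finset.erase_ssubset hi) (fun F hF => hx F (hF.trans (Finset.erase_subset _ _))) e g hg
      (Or.inr (by rw [Finset.card_erase_of_mem hi]; omega)) (h i hi)
  have hanti : ∀ i ∈ A, prodIdeal V Q A ≤ prodIdeal V Q (A.erase i) :=
    fun i _ => prodIdeal_anti (Finset.erase_subset _ _)
  have h1 := linForm_mul_mem_of_erase hA (key f d hf (by omega) fun i hi => hanti i hi h)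
  obtain ⟨x', hx'⟩ := Subspace.exists_forall_notMem (k := k) A.powerset
    fun F => F.sup V ⊔ (Q ⊔ k ∙ x)
  have hlt : Q < Q ⊔ k ∙ x := by
    refine lt_of_le_of_ne le_sup_left fun h => hxQ ?_
    rw [h]; exact le_sup_right (a := Q) (Submodule.mem_span_singleton_self x)
  have h2 := ihQ (Q ⊔ k ∙ x) hlt A x' (fun F hF => hx' F (Finset.mem_powerset.2 hF)) d f hf
    (Or.inr hcd) (prodIdeal_mono le_sup_left (h1 x'))
  rw [prodIdeal_sup_span] at h2
  obtain ⟨d, rfl⟩ : ∃ e, d = 1 + e := ⟨d - 1, by omega⟩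
  obtain ⟨g, hg, hfg⟩ := exists_homogeneous_sub_mul_mem (homogeneousSubmodule σ k)
    isHomogeneous_prodIdeal (isHomogeneous_linForm x) hf h2
  have hxg : (linForm x * g).IsHomogeneous (1 + d) := (isHomogeneous_linForm x).mul hg
  have h3 : linForm x * (linForm x * g) ∈ prodIdeal V Q A := by
    have := sub_mem h (Ideal.mul_mem_left _ (linForm x) hfg)
    rwa [← mul_sub, sub_sub_cancel] at this
  have h4 := linForm_mul_mem_of_erase hA (key g d hg (by omega)
    (key _ _ hxg (by omega) fun i hi => hanti i hi h3)) x
  simpa using add_mem hfg h4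

section Cube
variable {R : Type*} [CommRing R] [LinearOrder κ]

/-- The Koszul sign of inserting `i` into `B`. -/
def koszulSign (R : Type*) [CommRing R] (i : κ) (B : Finset κ) : R := (-1) ^ (B.filter (· < i)).card

/-- The `i`-th component of the differential of the cube complex. -/
def cubeDown (R : Type*) [CommRing R] (i : κ) : (Finset κ → R) →ₗ[R] (Finset κ → R) where
  toFun f B := if i ∈ B then 0 else koszulSign R i B * f (insert i B)
  map_add' f g := by ext B; by_cases h : i ∈ B <;> simp [h, mul_add]
  map_smul' c f := by ext B; by_cases h : i ∈ B <;> simp [h, mul_left_comm]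

/-- The homotopy contracting the `i`-th direction of the cube complex. -/
def cubeUp (R : Type*) [CommRing R] (i : κ) : (Finset κ → R) →ₗ[R] (Finset κ → R) where
  toFun f B := if i ∈ B then koszulSign R i B * f (B.erase i) else 0
  map_add' f g := by ext B; by_cases h : i ∈ B <;> simp [h, mul_add]
  map_smul' c f := by ext B; by_cases h : i ∈ B <;> simp [h, mul_left_comm]

theorem cubeDown_apply (i : κ) (f : Finset κ → R) (B : Finset κ) :
    cubeDown R i f B = if i ∈ B then 0 else koszulSign R i B * f (insert i B) := rfl

theorem cubeUp_apply (i : κ) (f : Finset κ → R) (B : Finset κ) :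
    cubeUp R i f B = if i ∈ B then koszulSign R i B * f (B.erase i) else 0 := rfl

theorem koszulSign_mul_self (i : κ) (B : Finset κ) : koszulSign R i B * koszulSign R i B = 1 := by
  rw [koszulSign, ← mul_pow]; simp

theorem koszulSign_insert {i j : κ} {B : Finset κ} (hj : j ∉ B) :
    koszulSign R i (insert j B) = (if j < i then -1 else 1) * koszulSign R i B := by
  rw [koszulSign, Finset.filter_insert]
  split_ifs with h
  · rw [Finset.card_insert_of_notMem (by simp [hj]), pow_succ', koszulSign]
  · rw [one_mul, koszulSign]

theorem koszulSign_insert_self {i : κ} {B : Finset κ} :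
    koszulSign R i (insert i B) = koszulSign R i B := by
  rw [koszulSign, Finset.filter_insert]; simp [koszulSign]

theorem koszulSign_erase_self {i : κ} {B : Finset κ} (hi : i ∈ B) :
    koszulSign R i (B.erase i) = koszulSign R i B := by
  conv_rhs => rw [← Finset.insert_erase hi, koszulSign_insert_self]

theorem cubeDown_cubeUp_self (i : κ) (f : Finset κ → R) :
    cubeDown R i (cubeUp R i f) + cubeUp R i (cubeDown R i f) = f := by
  ext B
  simp only [Pi.add_apply, cubeDown_apply, cubeUp_apply]
  by_cases h : i ∈ B
  · simp [h, koszulSign_erase_self h, ← mul_assoc, koszulSign_mul_self]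
  · simp [h, koszulSign_insert_self, ← mul_assoc, koszulSign_mul_self]

theorem cubeDown_cubeUp_of_ne {i j : κ} (hij : i ≠ j) (f : Finset κ → R) :
    cubeDown R i (cubeUp R j f) + cubeUp R j (cubeDown R i f) = 0 := by
  ext B
  simp only [Pi.add_apply, cubeDown_apply, cubeUp_apply, Pi.zero_apply]
  by_cases hi : i ∈ B
  · simp [hi, hij]
  by_cases hj : j ∈ B
  swap
  · simp [hj, hij.symm]
  obtain ⟨C, hC, rfl⟩ : ∃ C, j ∉ C ∧ insert j C = B :=
    ⟨B.erase j, Finset.notMem_erase _ _, Finset.insert_erase hj⟩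
  have hiC : i ∉ C := fun h => hi (Finset.mem_insert_of_mem h)
  have hji : j ∉ insert i C := by simp [hij.symm, hC]
  rw [if_neg hi, if_pos (by simp), if_pos hj, Finset.erase_insert hC, if_neg hiC,
    Finset.insert_comm i j C, Finset.erase_insert hji, koszulSign_insert_self,
    koszulSign_insert_self, koszulSign_insert hC, koszulSign_insert hiC]
  rcases lt_or_gt_of_ne hij with h | h
  · rw [if_pos h, if_neg h.not_gt]; ring
  · rw [if_pos h, if_neg h.not_gt]; ring

theorem cubeDown_cubeDown (i j : κ) (f : Finset κ → R) :
    cubeDown R i (cubeDown R j f) + cubeDown R j (cubeDown R i f) = 0 := by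
  ext B
  simp only [Pi.add_apply, cubeDown_apply, Pi.zero_apply]
  by_cases hij : i = j
  · subst hij; simp
  by_cases hi : i ∈ B
  · simp [hi]
  by_cases hj : j ∈ B
  · simp [hj]
  have h1 : j ∉ insert i B := by simp [hj, Ne.symm hij]
  have h2 : i ∉ insert j B := by simp [hi, hij]
  rw [if_neg hi, if_neg hj, if_neg h1, if_neg h2, koszulSign_insert hi, koszulSign_insert hj,
    Finset.insert_comm i j]
  rcases lt_or_gt_of_ne hij with h | h
  · rw [if_pos h, if_neg h.not_gt]; ring
  · rw [if_pos h, if_neg h.not_gt]; ring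

/-- The differential of the cube complex indexed by the subsets of `A`. -/
def cubeDiff (R : Type*) [CommRing R] (A : Finset κ) : (Finset κ → R) →ₗ[R] (Finset κ → R) :=
  ∑ i ∈ A, cubeDown R i

theorem cubeDiff_apply (A : Finset κ) (f : Finset κ → R) :
    cubeDiff R A f = ∑ i ∈ A, cubeDown R i f := by
  rw [cubeDiff, LinearMap.sum_apply]

theorem cubeDiff_cubeDiff [CharZero R] [IsDomain R] (A : Finset κ) (f : Finset κ → R) :
    cubeDiff R A (cubeDiff R A f) = 0 := by
  have h : cubeDiff R A (cubeDiff R A f) + cubeDiff R A (cubeDiff R A f) = 0 := by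
    simp only [cubeDiff_apply, map_sum]
    conv_lhs => arg 2; rw [Finset.sum_comm]
    rw [← Finset.sum_add_distrib]
    refine Finset.sum_eq_zero fun i _ => ?_
    rw [← Finset.sum_add_distrib]
    exact Finset.sum_eq_zero fun j _ => cubeDown_cubeDown _ _ _
  rw [← two_nsmul] at h
  ext B
  have := congrFun h B
  simpa using this

theorem cubeDiff_cubeUp {A : Finset κ} {j : κ} (hj : j ∈ A) (f : Finset κ → R) :
    cubeDiff R A (cubeUp R j f) + cubeUp R j (cubeDiff R A f) = f := by
  rw [cubeDiff_apply, cubeDiff_apply, map_sum, ← Finset.sum_add_distrib,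
    Finset.sum_eq_single_of_mem j hj fun i _ hi => cubeDown_cubeUp_of_ne hi f]
  exact cubeDown_cubeUp_self j f

end Cube

/-- Chains of the cube complex on the subsets of `A` with components in the ideals
`prodIdeal V Q B` and in the subspace `W`. -/
def cubeChains (V : κ → Submodule k (σ → k)) (Q : Submodule k (σ → k)) (A : Finset κ)
    (W : Submodule k (MvPolynomial σ k)) : Submodule k (Finset κ → MvPolynomial σ k) where
  carrier := {z | ∀ B, z B ∈ prodIdeal V Q B ∧ z B ∈ W ∧ (¬ B ⊆ A → z B = 0)}
  add_mem' {y z} hy hz B := ⟨add_mem (hy B).1 (hz B).1, add_mem (hy B).2.1 (hz B).2.1,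
    fun h => by simp [(hy B).2.2 h, (hz B).2.2 h]⟩
  zero_mem' B := ⟨zero_mem _, zero_mem _, fun _ => rfl⟩
  smul_mem' c z hz B := ⟨Submodule.smul_of_tower_mem _ c (hz B).1,
    Submodule.smul_mem _ c (hz B).2.1,
    fun h => by simp [(hz B).2.2 h]⟩

theorem cubeChains_mono {Q' : Submodule k (σ → k)} (h : Q ≤ Q')
    (W : Submodule k (MvPolynomial σ k)) : cubeChains V Q A W ≤ cubeChains V Q' A W :=
  fun _ hz B => ⟨prodIdeal_mono h (hz B).1, (hz B).2⟩

section
variable [LinearOrder κ]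

omit [Fintype σ] in
theorem koszulSign_mul_mem {M : Type*} [SetLike M (MvPolynomial σ k)]
    [AddSubgroupClass M (MvPolynomial σ k)] (S : M) (i : κ) (B : Finset κ) {f : MvPolynomial σ k}
    (hf : f ∈ S) : koszulSign _ i B * f ∈ S := by
  rcases neg_one_pow_eq_or (MvPolynomial σ k) (B.filter (· < i)).card with h | h
  · rwa [koszulSign, h, one_mul]
  · rw [koszulSign, h, neg_one_mul]; exact neg_mem hf

theorem cubeDown_mem_cubeChains {W : Submodule k (MvPolynomial σ k)} {i : κ}
    {z : Finset κ → MvPolynomial σ k} (hz : z ∈ cubeChains V Q A W) :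
    cubeDown _ i z ∈ cubeChains V Q A W := fun B => by
  rw [cubeDown_apply]
  split_ifs with h
  · exact ⟨zero_mem _, zero_mem _, fun _ => rfl⟩
  · refine ⟨koszulSign_mul_mem _ i B (prodIdeal_anti (Finset.subset_insert i B) (hz _).1),
      koszulSign_mul_mem _ i B (hz _).2.1, fun hB => ?_⟩
    rw [(hz _).2.2 fun h' => hB ((Finset.subset_insert i B).trans h'), mul_zero]

theorem cubeDiff_mem_cubeChains {W : Submodule k (MvPolynomial σ k)}
    {z : Finset κ → MvPolynomial σ k} (hz : z ∈ cubeChains V Q A W) :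
    cubeDiff _ A z ∈ cubeChains V Q A W := by
  rw [cubeDiff_apply]
  exact Submodule.sum_mem _ fun i _ => cubeDown_mem_cubeChains hz

theorem cubeUp_mem {W : Submodule k (MvPolynomial σ k)} {i : κ} (hi : i ∈ A)
    {z : Finset κ → MvPolynomial σ k} (hz : z ∈ cubeChains V Q A W) (B : Finset κ) :
    cubeUp _ i z B ∈ W ∧ (¬ B ⊆ A → cubeUp _ i z B = 0) := by
  rw [cubeUp_apply]
  split_ifs with h
  · refine ⟨koszulSign_mul_mem _ i B (hz _).2.1, fun hB => ?_⟩
    rw [(hz _).2.2 fun h' => hB ?_, mul_zero]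
    rw [← Finset.insert_erase h]
    exact Finset.insert_subset hi h'
  · exact ⟨zero_mem _, fun _ => rfl⟩

theorem smul_cubeUp_mem_cubeChains {d : ℕ} {i : κ} (hi : i ∈ A)
    {z : Finset κ → MvPolynomial σ k} (hz : z ∈ cubeChains V Q A (homogeneousSubmodule σ k d))
    {y : σ → k} (hy : y ∈ V i ∨ y ∈ Q) :
    linForm y • cubeUp _ i z ∈ cubeChains V Q A (homogeneousSubmodule σ k (1 + d)) := fun B => by
  have h := cubeUp_mem hi hz B
  refine ⟨?_, (isHomogeneous_linForm y).mul h.1, fun hB => ?_⟩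
  · rcases hy with hy | hy
    · rw [Pi.smul_apply, cubeUp_apply]
      split_ifs with hiB
      · have := mul_mem_prodIdeal_insert (Finset.notMem_erase i B) hy
          (koszulSign_mul_mem _ i B (hz (B.erase i)).1)
        rwa [Finset.insert_erase hiB] at this
      · simp
    · exact linIdeal_le_prodIdeal (Ideal.mul_mem_right _ _ (linForm_mem_linIdeal hy))
  · rw [Pi.smul_apply, h.2 hB, smul_zero]

/-- Exactness of the cube complex in high degrees. -/
theorem exists_cubeDiff_eq [CharZero k] (V : κ → Submodule k (σ → k)) (A : Finset κ)
    (hA : A.Nonempty) (Q : Submodule k (σ → k)) (htop : A.sup V ⊔ Q = ⊤) (d : ℕ) (hd : A.card ≤ d)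
    (z : Finset κ → MvPolynomial σ k) (hz : z ∈ cubeChains V Q A (homogeneousSubmodule σ k d))
    (hdz : cubeDiff _ A z = 0) :
    ∃ u ∈ cubeChains V Q A (homogeneousSubmodule σ k d), cubeDiff _ A u = z := by
  classical
  obtain ⟨i₀, hi₀⟩ := hA
  have hup : ∀ i ∈ A, ∀ z : Finset κ → MvPolynomial σ k, cubeDiff _ A z = 0 →
      cubeDiff _ A (cubeUp _ i z) = z := fun i hi z hz => by
    have := cubeDiff_cubeUp hi z
    rwa [hz, map_zero, add_zero] at this
  induction Q using WellFoundedGT.induction generalizing d z with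
  | ind Q ihQ =>
  by_cases hQ : Q = ⊤
  · subst hQ
    refine ⟨cubeUp _ i₀ z, fun B => ?_, hup i₀ hi₀ z hdz⟩
    have h := cubeUp_mem hi₀ hz B
    refine ⟨?_, h⟩
    by_cases hB : B ⊆ A
    · exact prodIdeal_top h.1 ((Finset.card_le_card hB).trans hd)
    · rw [h.2 hB]; exact zero_mem _
  obtain ⟨x, hx⟩ := Subspace.exists_forall_notMem (k := k) A.powerset fun F => F.sup V ⊔ Q
  have hxQ : x ∉ Q := by simpa using hx ∅ (by simp) (by simpa using hQ)
  have hlt : Q < Q ⊔ k ∙ x := by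
    refine lt_of_le_of_ne le_sup_left fun h => hxQ ?_
    rw [h]; exact le_sup_right (a := Q) (Submodule.mem_span_singleton_self x)
  obtain ⟨c, hc, q, hq, hcq⟩ := Submodule.mem_sup.1 (htop ▸ Submodule.mem_top : x ∈ A.sup V ⊔ Q)
  rw [Finset.sup_eq_iSup, Submodule.mem_iSup_finset_iff_exists_sum] at hc
  obtain ⟨y, hy⟩ := hc
  have hxy : linForm x = ∑ i ∈ A, linForm (y i : σ → k) + linForm q := by
    rw [← hcq, ← hy, map_add, map_sum]
  set h : Finset κ → MvPolynomial σ k :=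
    ∑ i ∈ A, linForm (y i : σ → k) • cubeUp _ i z + linForm q • cubeUp _ i₀ z with hh
  have hhm : h ∈ cubeChains V Q A (homogeneousSubmodule σ k (1 + d)) :=
    add_mem (Submodule.sum_mem _ fun i hi => smul_cubeUp_mem_cubeChains hi hz (Or.inl (y i).2))
      (smul_cubeUp_mem_cubeChains hi₀ hz (Or.inr hq))
  have hdh : cubeDiff _ A h = linForm x • z := by
    rw [hh, map_add, map_smul, map_sum, hup i₀ hi₀ z hdz, hxy, add_smul, Finset.sum_smul]
    congr 1
    exact Finset.sum_congr rfl fun i hi => by rw [map_smul, hup i hi z hdz]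
  have hu0 := cubeUp_mem hi₀ hz
  have hm : h - linForm x • cubeUp _ i₀ z ∈
      cubeChains V (Q ⊔ k ∙ x) A (homogeneousSubmodule σ k (1 + d)) :=
    sub_mem (cubeChains_mono le_sup_left _ hhm) (smul_cubeUp_mem_cubeChains hi₀
      (cubeChains_mono le_sup_left _ hz)
      (Or.inr (le_sup_right (a := Q) (Submodule.mem_span_singleton_self x))))
  obtain ⟨u, hu, hdu⟩ := ihQ (Q ⊔ k ∙ x) hlt (by rw [← sup_assoc, htop, top_sup_eq]) (1 + d)
    (by omega) _ hm (by rw [map_sub, map_smul, hdh, hup i₀ hi₀ z hdz, sub_self])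
  have hsplit : ∀ B, ∃ g ∈ homogeneousSubmodule σ k d,
      u B - linForm x * g ∈ prodIdeal V Q B ∧ (¬ B ⊆ A → g = 0) := fun B => by
    by_cases hB : B ⊆ A
    · have h1 := (hu B).1
      rw [prodIdeal_sup_span] at h1
      obtain ⟨g, hg, hgu⟩ := exists_homogeneous_sub_mul_mem (homogeneousSubmodule σ k)
        isHomogeneous_prodIdeal (isHomogeneous_linForm x) (hu B).2.1 h1
      exact ⟨g, hg, hgu, fun h => absurd hB h⟩
    · exact ⟨0, zero_mem _, by simp [(hu B).2.2 hB], fun _ => rfl⟩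
  choose u₂ hu₂ hu₁ hu₂0 using hsplit
  have hu₁m : u - linForm x • u₂ ∈ cubeChains V Q A (homogeneousSubmodule σ k (1 + d)) :=
    fun B => ⟨hu₁ B, sub_mem (hu B).2.1 ((isHomogeneous_linForm x).mul (hu₂ B)),
      fun hB => by simp [(hu B).2.2 hB, hu₂0 B hB]⟩
  have hu₂m : u₂ ∈ cubeChains V ⊤ A (homogeneousSubmodule σ k d) := fun B => by
    refine ⟨?_, hu₂ B, hu₂0 B⟩
    by_cases hB : B ⊆ A
    · exact prodIdeal_top (hu₂ B) ((Finset.card_le_card hB).trans hd)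
    · rw [hu₂0 B hB]; exact zero_mem _
  have hdu₂ := cubeDiff_mem_cubeChains hu₂m
  have hxu : linForm x • (cubeUp _ i₀ z + cubeDiff _ A u₂) =
      h - cubeDiff _ A (u - linForm x • u₂) := by
    rw [map_sub, hdu, map_smul, smul_add]; abel
  have hxm : linForm x • (cubeUp _ i₀ z + cubeDiff _ A u₂) ∈
      cubeChains V Q A (homogeneousSubmodule σ k (1 + d)) := by
    rw [hxu]; exact sub_mem hhm (cubeDiff_mem_cubeChains hu₁m)
  refine ⟨cubeUp _ i₀ z + cubeDiff _ A u₂, fun B => ?_, ?_⟩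
  · have hW : (cubeUp _ i₀ z + cubeDiff _ A u₂) B ∈ homogeneousSubmodule σ k d :=
      add_mem (hu0 B).1 (hdu₂ B).2.1
    have h0 : ¬ B ⊆ A → (cubeUp _ i₀ z + cubeDiff _ A u₂) B = 0 := fun hB => by
      rw [Pi.add_apply, (hu0 B).2 hB, (hdu₂ B).2.2 hB, add_zero]
    refine ⟨?_, hW, h0⟩
    by_cases hB : B ⊆ A
    · exact mem_of_linForm_mul_mem V Q B x
        (fun F hF => hx F (Finset.mem_powerset.2 (hF.trans hB))) d _ hW
        (Or.inr ((Finset.card_le_card hB).trans hd)) (hxm B).1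
    · rw [h0 hB]; exact zero_mem _
  · rw [map_add, hup i₀ hi₀ z hdz, cubeDiff_cubeDiff, add_zero]
end

/-- Functions with values in prescribed subspaces and supported on a given finite set. -/
def supportedPi {ι M : Type*} [AddCommGroup M] [Module k M] (U : ι → Submodule k M) (s : Finset ι) :
    Submodule k (ι → M) where
  carrier := {z | ∀ i, z i ∈ U i ∧ (i ∉ s → z i = 0)}
  add_mem' {y z} hy hz i := ⟨add_mem (hy i).1 (hz i).1,
    fun h => by simp [(hy i).2 h, (hz i).2 h]⟩
  zero_mem' i := ⟨zero_mem _, fun _ => rfl⟩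
  smul_mem' c z hz i := ⟨Submodule.smul_mem _ c (hz i).1, fun h => by simp [(hz i).2 h]⟩

/-- Functions supported on `s` are families indexed by `s`. -/
def supportedPiEquiv {ι M : Type*} [AddCommGroup M] [Module k M] [DecidableEq ι]
    (U : ι → Submodule k M) (s : Finset ι) : supportedPi U s ≃ₗ[k] ((i : s) → U i) where
  toFun z i := ⟨z.1 i, (z.2 i).1⟩
  map_add' _ _ := rfl
  map_smul' _ _ := rfl
  invFun f := ⟨fun i => if h : i ∈ s then f ⟨i, h⟩ else 0, fun i => by
    by_cases h : i ∈ s <;> simp [h]⟩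
  left_inv z := by
    ext i
    by_cases h : i ∈ s <;> simp [h, (z.2 i).2]
  right_inv f := by ext i; simp

theorem finite_supportedPi {ι M : Type*} [AddCommGroup M] [Module k M]
    (U : ι → Submodule k M) (s : Finset ι) (h : ∀ i, Module.Finite k (U i)) :
    Module.Finite k (supportedPi U s) := by
  classical
  exact Module.Finite.equiv (supportedPiEquiv U s).symm

theorem finrank_supportedPi {ι M : Type*} [AddCommGroup M] [Module k M]
    (U : ι → Submodule k M) (s : Finset ι) (h : ∀ i, Module.Finite k (U i)) :
    Module.finrank k (supportedPi U s) = ∑ i ∈ s, Module.finrank k (U i) := by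
  classical
  rw [(supportedPiEquiv U s).finrank_eq, Module.finrank_pi_fintype,
    Finset.sum_coe_sort s fun i => Module.finrank k (U i)]

theorem Submodule.finrank_map_add_finrank_inf_ker {M N : Type*} [AddCommGroup M] [Module k M]
    [AddCommGroup N] [Module k N] (f : M →ₗ[k] N) (U : Submodule k M) [Module.Finite k U] :
    Module.finrank k (U.map f) + Module.finrank k (U ⊓ LinearMap.ker f : Submodule k M) =
      Module.finrank k U := by
  rw [← LinearMap.finrank_range_add_finrank_ker (f.domRestrict U), LinearMap.range_domRestrict,
    LinearMap.ker_domRestrict]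
  congr 1
  rw [← Submodule.map_comap_subtype]
  exact (Submodule.equivMapOfInjective U.subtype U.injective_subtype _).finrank_eq.symm

/-- The part of `prodIdeal V Q A` in the subspace `W`. -/
def prodPiece (V : κ → Submodule k (σ → k)) (Q : Submodule k (σ → k)) (A : Finset κ)
    (W : Submodule k (MvPolynomial σ k)) : Submodule k (MvPolynomial σ k) :=
  (prodIdeal V Q A).restrictScalars k ⊓ W

instance (W : Submodule k (MvPolynomial σ k)) [Module.Finite k W] :
    Module.Finite k (prodPiece V Q A W) :=
  Submodule.finiteDimensional_of_le (inf_le_right : _ ≤ W)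

theorem cubeDiff_apply_apply {R : Type*} [CommRing R] [LinearOrder κ] (z : Finset κ → R)
    (B : Finset κ) : cubeDiff R A z B =
      ∑ i ∈ A, if i ∈ B then 0 else koszulSign R i B * z (insert i B) := by
  rw [cubeDiff_apply, Finset.sum_apply]; rfl

theorem sum_neg_one_pow_finrank_prodPiece [CharZero k] [LinearOrder κ]
    (W : Submodule k (MvPolynomial σ k))
    [Module.Finite k W]
    (hex : ∀ z ∈ cubeChains V Q A W, cubeDiff _ A z = 0 →
      ∃ u ∈ cubeChains V Q A W, cubeDiff _ A u = z) :
    ∑ B ∈ A.powerset, (-1 : ℤ) ^ B.card * Module.finrank k (prodPiece V Q B W) = 0 := by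
  classical
  let s (p : ZMod 2) := A.powerset.filter fun B => (B.card : ZMod 2) = p
  let C (p : ZMod 2) := supportedPi (fun B => prodPiece V Q B W) (s p)
  have hfin (p : ZMod 2) : Module.Finite k (C p) := finite_supportedPi _ _ fun _ => inferInstance
  let D : (Finset κ → MvPolynomial σ k) →ₗ[k] (Finset κ → MvPolynomial σ k) :=
    (cubeDiff _ A).restrictScalars k
  have two : ∀ p : ZMod 2, p + 1 + 1 = p := by decide
  have hC (p : ZMod 2) : C p ≤ cubeChains V Q A W := fun z hz B => ⟨(hz B).1.1, (hz B).1.2,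
    fun hB => (hz B).2 (by simp [s, hB])⟩
  have hD (p : ZMod 2) : (C (p + 1)).map D = C p ⊓ LinearMap.ker D := by
    ext z
    constructor
    · rintro ⟨u, hu, rfl⟩
      have h1 := cubeDiff_mem_cubeChains (hC _ hu)
      refine ⟨fun B => ⟨⟨(h1 B).1, (h1 B).2.1⟩, fun hB => ?_⟩, cubeDiff_cubeDiff A u⟩
      by_cases hBA : B ⊆ A
      · change cubeDiff _ A u B = 0
        rw [cubeDiff_apply_apply]
        refine Finset.sum_eq_zero fun i hi => ?_
        split_ifs with h
        · rfl
        · rw [(hu _).2, mul_zero]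
          intro h'
          rw [Finset.mem_filter, Finset.card_insert_of_notMem h, Nat.cast_add, Nat.cast_one] at h'
          exact hB (Finset.mem_filter.2 ⟨Finset.mem_powerset.2 hBA, add_right_cancel h'.2⟩)
      · exact (h1 B).2.2 hBA
    · rintro ⟨hz, hz0⟩
      obtain ⟨u, hu, hdu⟩ := hex z (hC _ hz) hz0
      refine ⟨fun B => if (B.card : ZMod 2) = p + 1 then u B else 0, fun B => ?_, ?_⟩
      · beta_reduce
        split_ifs with h
        · exact ⟨⟨(hu B).1, (hu B).2.1⟩, fun hB => (hu B).2.2 fun hBA =>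
            hB (Finset.mem_filter.2 ⟨Finset.mem_powerset.2 hBA, h⟩)⟩
        · exact ⟨zero_mem _, fun _ => rfl⟩
      · ext1 B
        change cubeDiff _ A _ B = _
        rw [cubeDiff_apply_apply]
        by_cases hB : (B.card : ZMod 2) = p
        · rw [← hdu, cubeDiff_apply_apply]
          refine Finset.sum_congr rfl fun i hi => ?_
          split_ifs with h h'
          · rfl
          · rfl
          · rw [Finset.card_insert_of_notMem h, Nat.cast_add, Nat.cast_one, hB] at h'
            exact absurd rfl h'
        · rw [(hz B).2 (by simp [s, hB])]
          refine Finset.sum_eq_zero fun i hi => ?_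
          split_ifs with h h'
          · rfl
          · rw [Finset.card_insert_of_notMem h, Nat.cast_add, Nat.cast_one] at h'
            exact absurd (add_right_cancel h') hB
          · simp
  have hrank (p : ZMod 2) := Submodule.finrank_map_add_finrank_inf_ker D (C p)
  have h0 := hrank 0
  have h1 := hrank 1
  rw [← hD] at h0 h1
  rw [show (1 : ZMod 2) + 1 = 0 from rfl] at h1
  rw [zero_add] at h0
  have h01 : Module.finrank k (C 0) = Module.finrank k (C 1) := by omega
  rw [finrank_supportedPi _ _ fun _ => inferInstance,
    finrank_supportedPi _ _ fun _ => inferInstance] at h01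
  rw [← Finset.sum_filter_add_sum_filter_not A.powerset fun B => (B.card : ZMod 2) = 0]
  have hs1 : (A.powerset.filter fun B => ¬ (B.card : ZMod 2) = 0) = s 1 := by
    refine Finset.filter_congr fun B _ => ?_
    generalize (B.card : ZMod 2) = a
    revert a; decide
  rw [hs1]
  have e0 : ∑ B ∈ s 0, (-1 : ℤ) ^ B.card * Module.finrank k (prodPiece V Q B W) =
      ∑ B ∈ s 0, (Module.finrank k (prodPiece V Q B W) : ℤ) := by
    refine Finset.sum_congr rfl fun B hB => ?_
    have := (ZMod.natCast_eq_zero_iff_even).1 (Finset.mem_filter.1 hB).2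
    rw [this.neg_one_pow, one_mul]
  have e1 : ∑ B ∈ s 1, (-1 : ℤ) ^ B.card * Module.finrank k (prodPiece V Q B W) =
      -∑ B ∈ s 1, (Module.finrank k (prodPiece V Q B W) : ℤ) := by
    rw [← Finset.sum_neg_distrib]
    refine Finset.sum_congr rfl fun B hB => ?_
    have := (ZMod.natCast_eq_one_iff_odd).1 (Finset.mem_filter.1 hB).2
    rw [this.neg_one_pow, neg_one_mul]
  change ∑ B ∈ s 0, _ + _ = _
  rw [e0, e1]
  have := congrArg (Nat.cast : ℕ → ℤ) h01
  push_cast at this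
  rw [this, add_neg_cancel]

attribute [local instance] MvPolynomial.weightedGradedAlgebra

theorem linForm_single [DecidableEq σ] (s : σ) :
    linForm (Pi.single s 1 : σ → k) = X s := by
  rw [linForm_apply, Finset.sum_eq_single s (fun t _ h => by simp [h]) (by simp)]
  simp

theorem coeff_linForm (y : σ → k) (s : σ) : coeff (Finsupp.single s 1) (linForm y) = y s := by
  classical
  rw [linForm_apply, coeff_sum, Finset.sum_eq_single s _ (by simp)]
  · simp
  · intro t _ h
    rw [coeff_smul, coeff_X, if_neg, smul_zero]
    rw [Finsupp.single_left_inj one_ne_zero]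
    exact h

theorem linForm_injective : Function.Injective (linForm : (σ → k) →ₗ[k] MvPolynomial σ k) :=
  fun y z h => funext fun s => by rw [← coeff_linForm y s, h, coeff_linForm]

theorem finrank_prodPiece_sup_span {M : Type*} [AddCommMonoid M] [IsCancelAdd M]
    [DecidableEq M] (w : σ → M)
    (hI : (prodIdeal V Q A).IsHomogeneous (weightedHomogeneousSubmodule k w)) {e α : M}
    {x : σ → k} (hx : linForm x ∈ weightedHomogeneousSubmodule k w e) (hx0 : x ≠ 0)
    (hreg : ∀ g ∈ weightedHomogeneousSubmodule k w α,
      linForm x * g ∈ prodIdeal V Q A → g ∈ prodIdeal V Q A)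
    [Module.Finite k (weightedHomogeneousSubmodule k w α)]
    [Module.Finite k (weightedHomogeneousSubmodule k w (e + α))] :
    Module.finrank k (prodPiece V (Q ⊔ k ∙ x) A (weightedHomogeneousSubmodule k w (e + α))) +
        Module.finrank k (prodPiece V Q A (weightedHomogeneousSubmodule k w α)) =
      Module.finrank k (prodPiece V Q A (weightedHomogeneousSubmodule k w (e + α))) +
        Module.finrank k (weightedHomogeneousSubmodule k w α) := by
  set m : MvPolynomial σ k →ₗ[k] MvPolynomial σ k := LinearMap.mulLeft k (linForm x) with hm
  have hinj : Function.Injective m := mul_right_injective₀ fun h => hx0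
    (linForm_injective (by rw [h, map_zero]))
  have hmul : ∀ g ∈ weightedHomogeneousSubmodule k w α,
      linForm x * g ∈ weightedHomogeneousSubmodule k w (e + α) := fun g hg =>
    IsWeightedHomogeneous.mul hx hg
  have hsup : prodPiece V (Q ⊔ k ∙ x) A (weightedHomogeneousSubmodule k w (e + α)) =
      prodPiece V Q A (weightedHomogeneousSubmodule k w (e + α)) ⊔
        (weightedHomogeneousSubmodule k w α).map m := by
    apply le_antisymm
    · rintro f ⟨hf, hfW⟩
      rw [Submodule.coe_restrictScalars, SetLike.mem_coe, prodIdeal_sup_span] at hf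
      obtain ⟨g, hg, hgf⟩ := exists_homogeneous_sub_mul_mem _ hI hx hfW hf
      exact Submodule.mem_sup.2 ⟨_, ⟨hgf, sub_mem hfW (hmul g hg)⟩, _, ⟨g, hg, rfl⟩,
        sub_add_cancel _ _⟩
    · refine sup_le (fun f hf => ⟨prodIdeal_mono le_sup_left hf.1, hf.2⟩) ?_
      rintro _ ⟨g, hg, rfl⟩
      refine ⟨?_, hmul g hg⟩
      exact linIdeal_le_prodIdeal (Ideal.mul_mem_right _ _ (linForm_mem_linIdeal
        (le_sup_right (a := Q) (Submodule.mem_span_singleton_self x))))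
  have hinf : prodPiece V Q A (weightedHomogeneousSubmodule k w (e + α)) ⊓
      (weightedHomogeneousSubmodule k w α).map m =
        (prodPiece V Q A (weightedHomogeneousSubmodule k w α)).map m := by
    apply le_antisymm
    · rintro _ ⟨hf, g, hg, rfl⟩
      exact ⟨g, ⟨hreg g hg hf.1, hg⟩, rfl⟩
    · rintro _ ⟨g, hg, rfl⟩
      exact ⟨⟨Ideal.mul_mem_left _ _ hg.1, hmul g hg.2⟩, g, hg.2, rfl⟩
  have h := Submodule.finrank_sup_add_finrank_inf_eq
    (prodPiece V Q A (weightedHomogeneousSubmodule k w (e + α)))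
    ((weightedHomogeneousSubmodule k w α).map m)
  rwa [← hsup, hinf, ← (Submodule.equivMapOfInjective m hinj _).finrank_eq,
    ← (Submodule.equivMapOfInjective m hinj _).finrank_eq] at h

theorem prodIdeal_le_pow_idealOfVars :
    ∏ j ∈ A, linIdeal (V j) ≤ idealOfVars σ k ^ A.card := by
  classical
  rw [← Finset.prod_const]
  refine Finset.prod_le_prod' fun j _ => linIdeal_le_iff.2 fun y _ => ?_
  rw [linForm_apply]
  exact Submodule.sum_mem _ fun s _ => Submodule.smul_of_tower_mem _ _
    (Ideal.subset_span ⟨s, rfl⟩)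

/-- In degrees below `A.card` the product does not contribute. -/
theorem mem_linIdeal_of_mem_prodIdeal {f : MvPolynomial σ k} {d : ℕ} (hf : f.IsHomogeneous d)
    (hd : d < A.card) (h : f ∈ prodIdeal V Q A) : f ∈ linIdeal Q := by
  obtain ⟨a, ha, b, hb, rfl⟩ := Submodule.mem_sup.1 h
  have h1 : homogeneousComponent d (a + b) = a + b := by
    rw [homogeneousComponent_of_mem hf, if_pos rfl]
  have h2 : homogeneousComponent d a = 0 := by
    refine homogeneousComponent_eq_zero' _ _ fun m hm hmd => ?_
    have := (mem_pow_idealOfVars_iff _ _).1 (prodIdeal_le_pow_idealOfVars ha) m hm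
    omega
  rw [map_add, h2, zero_add] at h1
  rw [← h1]
  exact homogeneousComponent_mem_of_mem (isHomogeneous_linIdeal Q) hb d

section Color
variable {ι τ : Type*}

/-- The grading of polynomials in the variables `(i, t)` by the number of variables of each
color `i`. -/
def colorWeight (s : ι × τ) : ι →₀ ℕ := Finsupp.single s.1 1

/-- Vectors whose component of each color `i` lies in `U i`. -/
def colorSub (U : ι → Submodule k (τ → k)) : Submodule k (ι × τ → k) where
  carrier := {y | ∀ i, (fun t => y (i, t)) ∈ U i}
  add_mem' hy hz i := add_mem (hy i) (hz i)
  zero_mem' _ := zero_mem _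
  smul_mem' c _ hy i := Submodule.smul_mem _ c (hy i)

/-- The vectors of color `i`. -/
def colorEmb [DecidableEq ι] (i : ι) : (τ → k) →ₗ[k] (ι × τ → k) where
  toFun y s := if s.1 = i then y s.2 else 0
  map_add' y z := by ext s; by_cases h : s.1 = i <;> simp [h]
  map_smul' c y := by ext s; by_cases h : s.1 = i <;> simp [h]

theorem colorEmb_apply [DecidableEq ι] (i : ι) (y : τ → k) (s : ι × τ) :
    colorEmb i y s = if s.1 = i then y s.2 else 0 := rfl

theorem colorEmb_mem_iff [DecidableEq ι] {U : ι → Submodule k (τ → k)} {i : ι} {y : τ → k} :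
    colorEmb i y ∈ colorSub U ↔ y ∈ U i := by
  refine ⟨fun h => by simpa [colorEmb_apply] using h i, fun h j => ?_⟩
  by_cases hj : j = i
  · subst hj; simpa [colorEmb_apply] using h
  · simp only [colorEmb_apply, if_neg hj]; exact zero_mem _

theorem sum_colorEmb [DecidableEq ι] [Fintype ι] (y : ι × τ → k) :
    ∑ i, colorEmb i (fun t => y (i, t)) = y := by
  ext ⟨j, t⟩
  simp [Finset.sum_apply, colorEmb_apply]

theorem colorSub_mono {U U' : ι → Submodule k (τ → k)} (h : ∀ i, U i ≤ U' i) :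
    colorSub U ≤ colorSub U' := fun _ hy i => h i (hy i)

theorem colorSub_sup (U U' : ι → Submodule k (τ → k)) :
    colorSub U ⊔ colorSub U' = colorSub fun i => U i ⊔ U' i := by
  refine le_antisymm (sup_le (colorSub_mono fun i => le_sup_left)
    (colorSub_mono fun i => le_sup_right)) fun y hy => ?_
  choose a ha b hb hab using fun i => Submodule.mem_sup.1 (hy i)
  refine Submodule.mem_sup.2 ⟨fun s => a s.1 s.2, ha, fun s => b s.1 s.2, hb, ?_⟩
  ext ⟨i, t⟩
  exact congrFun (hab i) t

theorem colorSub_finset_sup (L : κ → Submodule k (τ → k)) (A : Finset κ) :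
    (A.sup fun j => colorSub fun _ : ι => L j) = colorSub fun _ => A.sup L := by
  classical
  induction A using Finset.induction_on with
  | empty =>
    rw [Finset.sup_empty, Finset.sup_empty, eq_comm, eq_bot_iff]
    intro y hy
    rw [Submodule.mem_bot]
    ext ⟨i, t⟩
    exact congrFun ((Submodule.mem_bot k).1 (hy i)) t
  | insert j A hj ih =>
    rw [Finset.sup_insert, Finset.sup_insert, ih, colorSub_sup]

theorem colorSub_eq_top {U : ι → Submodule k (τ → k)} (h : ∀ i, U i = ⊤) : colorSub U = ⊤ :=
  eq_top_iff.2 fun _ _ i => by rw [h i]; trivial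

theorem colorSub_update [DecidableEq ι] (U : ι → Submodule k (τ → k)) (i : ι) (x : τ → k) :
    colorSub (Function.update U i (U i ⊔ k ∙ x)) = colorSub U ⊔ k ∙ colorEmb i x := by
  apply le_antisymm
  · intro y hy
    have hyi := hy i
    rw [Function.update_self] at hyi
    obtain ⟨a, ha, b, hb, hab⟩ := Submodule.mem_sup.1 hyi
    obtain ⟨c, rfl⟩ := Submodule.mem_span_singleton.1 hb
    refine Submodule.mem_sup.2 ⟨y - c • colorEmb i x, fun j => ?_, c • colorEmb i x,
      Submodule.mem_span_singleton.2 ⟨c, rfl⟩, sub_add_cancel _ _⟩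
    by_cases hj : j = i
    · subst hj
      convert ha using 1
      ext t
      have := congrFun hab t
      simp only [Pi.add_apply, Pi.smul_apply] at this
      simp [colorEmb_apply, ← this]
    · have := hy j
      rw [Function.update_of_ne hj] at this
      simpa [colorEmb_apply, hj] using this
  · refine sup_le (colorSub_mono fun j => ?_) ?_
    · by_cases hj : j = i
      · subst hj; rw [Function.update_self]; exact le_sup_left
      · rw [Function.update_of_ne hj]
    · rw [Submodule.span_singleton_le_iff_mem, colorEmb_mem_iff, Function.update_self]
      exact le_sup_right (a := U i) (Submodule.mem_span_singleton_self x)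

variable [Fintype ι] [Fintype τ] [DecidableEq ι]

theorem linForm_colorEmb_mem (i : ι) (y : τ → k) : linForm (colorEmb i y) ∈
    weightedHomogeneousSubmodule k (colorWeight : ι × τ → ι →₀ ℕ) (Finsupp.single i 1) := by
  rw [linForm_apply]
  refine Submodule.sum_mem _ fun s _ => ?_
  rw [colorEmb_apply]
  split_ifs with h
  · exact Submodule.smul_mem _ _ (h ▸ isWeightedHomogeneous_X k colorWeight s)
  · rw [zero_smul]; exact zero_mem _

theorem isHomogeneous_linIdeal_colorSub (U : ι → Submodule k (τ → k)) :
    (linIdeal (colorSub U)).IsHomogeneous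
      (weightedHomogeneousSubmodule k (colorWeight : ι × τ → ι →₀ ℕ)) := by
  have : linIdeal (colorSub U) =
      Ideal.span {f | ∃ i, ∃ y ∈ U i, f = linForm (colorEmb i y)} := by
    apply le_antisymm
    · refine linIdeal_le_iff.2 fun y hy => ?_
      rw [← sum_colorEmb y, map_sum]
      exact Submodule.sum_mem _ fun i _ => Ideal.subset_span ⟨i, _, hy i, rfl⟩
    · rw [Ideal.span_le]
      rintro _ ⟨i, y, hy, rfl⟩
      exact linForm_mem_linIdeal (colorEmb_mem_iff.2 hy)
  rw [this]
  refine Ideal.homogeneous_span _ _ ?_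
  rintro _ ⟨i, y, -, rfl⟩
  exact ⟨_, linForm_colorEmb_mem i y⟩

theorem isHomogeneous_prodIdeal_colorSub (L : κ → Submodule k (τ → k))
    (U : ι → Submodule k (τ → k)) (A : Finset κ) :
    (prodIdeal (fun j => colorSub fun _ => L j) (colorSub U) A).IsHomogeneous
      (weightedHomogeneousSubmodule k (colorWeight : ι × τ → ι →₀ ℕ)) :=
  Ideal.IsHomogeneous.sup (Ideal.IsHomogeneous.finsetProd _ A _
    fun _ _ => isHomogeneous_linIdeal_colorSub _) (isHomogeneous_linIdeal_colorSub U)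

omit [Fintype ι] [Fintype τ] [DecidableEq ι] in
theorem colorPart_le (α : ι →₀ ℕ) :
    weightedHomogeneousSubmodule k (colorWeight : ι × τ → ι →₀ ℕ) α ≤
      homogeneousSubmodule (ι × τ) k α.degree := by
  intro f hf d hd
  rw [← hf hd, Finsupp.weight_apply, Finsupp.weight_apply, Finsupp.sum, Finsupp.sum, map_sum]
  simp [colorWeight]

instance (α : ι →₀ ℕ) :
    Module.Finite k (weightedHomogeneousSubmodule k (colorWeight : ι × τ → ι →₀ ℕ) α) := by
  have : Module.Finite k (homogeneousSubmodule (ι × τ) k α.degree) :=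
    Module.Finite.iff_fg.2 (weightedHomogeneousSubmodule_fg k 1 (fun _ => one_ne_zero) _)
  exact Submodule.finiteDimensional_of_le (colorPart_le α)

/-- If the color `i` does not occur in `α`, linear forms of color `i` do not matter. -/
theorem mem_of_mem_sup_span {I : Ideal (MvPolynomial (ι × τ) k)}
    (hI : I.IsHomogeneous (weightedHomogeneousSubmodule k (colorWeight : ι × τ → ι →₀ ℕ)))
    {i : ι} {α : ι →₀ ℕ} (hα : α i = 0) (x : τ → k) {f : MvPolynomial (ι × τ) k}
    (hf : f ∈ weightedHomogeneousSubmodule k (colorWeight : ι × τ → ι →₀ ℕ) α)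
    (h : f ∈ I ⊔ Ideal.span {linForm (colorEmb i x)}) : f ∈ I := by
  classical
  obtain ⟨p, hp, q, hq, rfl⟩ := Submodule.mem_sup.1 h
  obtain ⟨g, rfl⟩ := Ideal.mem_span_singleton'.1 hq
  have h1 := IsWeightedHomogeneous.weightedHomogeneousComponent_same hf
  have h2 : weightedHomogeneousComponent (colorWeight : ι × τ → ι →₀ ℕ) α
      (g * linForm (colorEmb i x)) = 0 := by
    refine weightedHomogeneousComponent_eq_zero' _ _ fun m hm hmα => ?_
    rw [mem_support_iff] at hm
    apply hm
    rw [linForm_apply, Finset.mul_sum, coeff_sum]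
    refine Finset.sum_eq_zero fun s _ => ?_
    rw [mul_smul_comm, coeff_smul, coeff_mul_X', colorEmb_apply]
    by_cases hs : s.1 = i
    · have hsm : s ∉ m.support := fun hsm => by
        have h3 := DFunLike.congr_fun hmα i
        rw [hα, Finsupp.weight_apply, Finsupp.sum, Finsupp.finsetSum_apply,
          Finset.sum_eq_zero_iff] at h3
        have := h3 s hsm
        simp [colorWeight, hs] at this
        exact (Finsupp.mem_support_iff.1 hsm) this
      rw [if_neg hsm]; exact smul_zero _
    · rw [if_neg hs]; exact zero_smul k _
  rw [map_add, h2, add_zero] at h1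
  rw [← h1]
  exact weightedHomogeneousComponent_mem_of_mem _ _ hI hp α
end Color

section ColorPiece
variable {ι τ : Type*} [Fintype ι] [Fintype τ] [DecidableEq ι]

/-- The part of color content `α` of the ideal generated by the products over `j ∈ A` of the linear
forms with all components in `L j`, and by the linear forms with components in `U i`. -/
def colorPiece (L : κ → Submodule k (τ → k)) (U : ι → Submodule k (τ → k)) (A : Finset κ)
    (α : ι →₀ ℕ) : Submodule k (MvPolynomial (ι × τ) k) :=
  prodPiece (fun j => colorSub fun _ => L j) (colorSub U) A
    (weightedHomogeneousSubmodule k (colorWeight : ι × τ → ι →₀ ℕ) α)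

variable {L L' : κ → Submodule k (τ → k)} {U U' : ι → Submodule k (τ → k)}

omit [Fintype ι] [Fintype τ] [DecidableEq ι] in
theorem sup_colorSub (L : κ → Submodule k (τ → k)) (U : ι → Submodule k (τ → k)) (A : Finset κ) :
    (A.sup fun j => colorSub fun _ : ι => L j) ⊔ colorSub U = colorSub fun i => A.sup L ⊔ U i := by
  rw [colorSub_finset_sup, colorSub_sup]

theorem finrank_colorPiece_update [CharZero k] {i : ι} {x : τ → k} (hx : x ∉ A.sup L ⊔ U i)
    (α : ι →₀ ℕ) :
    Module.finrank k (colorPiece L (Function.update U i (U i ⊔ k ∙ x)) A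
        (Finsupp.single i 1 + α)) + Module.finrank k (colorPiece L U A α) =
      Module.finrank k (colorPiece L U A (Finsupp.single i 1 + α)) +
        Module.finrank k (weightedHomogeneousSubmodule k (colorWeight : ι × τ → ι →₀ ℕ) α) := by
  have hx' : colorEmb i x ∉ (A.sup fun j => colorSub fun _ : ι => L j) ⊔ colorSub U := by
    rw [sup_colorSub]; exact fun h => hx ((colorEmb_mem_iff (U := fun i => A.sup L ⊔ U i)).1 h)
  have hx0 : colorEmb i x ≠ 0 := fun h => hx' (by rw [h]; exact zero_mem _)
  have hreg : ∀ g ∈ weightedHomogeneousSubmodule k (colorWeight : ι × τ → ι →₀ ℕ) α,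
      linForm (colorEmb i x) * g ∈ prodIdeal (fun j => colorSub fun _ => L j) (colorSub U) A →
        g ∈ prodIdeal (fun j => colorSub fun _ => L j) (colorSub U) A := fun g hg h =>
    mem_of_pow_mul_mem hx' α.degree 1 g (colorPart_le α hg) (by rwa [pow_one])
  unfold colorPiece
  rw [colorSub_update]
  exact finrank_prodPiece_sup_span _ (isHomogeneous_prodIdeal_colorSub L U A)
    (linForm_colorEmb_mem i x) hx0 hreg

theorem colorPiece_update_of_eq_zero {i : ι} {α : ι →₀ ℕ} (hα : α i = 0) (x : τ → k) :
    colorPiece L (Function.update U i (U i ⊔ k ∙ x)) A α = colorPiece L U A α := by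
  unfold colorPiece
  rw [colorSub_update]
  refine le_antisymm ?_ fun f hf => ⟨prodIdeal_mono le_sup_left hf.1, hf.2⟩
  rintro f ⟨hf, hfW⟩
  rw [Submodule.coe_restrictScalars, SetLike.mem_coe, prodIdeal_sup_span] at hf
  exact ⟨mem_of_mem_sup_span (isHomogeneous_prodIdeal_colorSub L U A) hα x hfW hf, hfW⟩

theorem finrank_colorPiece_eq_of_update [CharZero k] {i : ι} {x x' : τ → k}
    (hx : x ∉ A.sup L ⊔ U i) (hx' : x' ∉ A.sup L' ⊔ U' i)
    (h : ∀ α, Module.finrank k (colorPiece L (Function.update U i (U i ⊔ k ∙ x)) A α) =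
      Module.finrank k (colorPiece L' (Function.update U' i (U' i ⊔ k ∙ x')) A α))
    (α : ι →₀ ℕ) :
    Module.finrank k (colorPiece L U A α) = Module.finrank k (colorPiece L' U' A α) := by
  induction hn : α i generalizing α with
  | zero =>
    have := h α
    rwa [colorPiece_update_of_eq_zero hn, colorPiece_update_of_eq_zero hn] at this
  | succ n ih =>
    obtain ⟨β, rfl⟩ : ∃ β, α = Finsupp.single i 1 + β :=
      ⟨α - Finsupp.single i 1, by
        rw [add_tsub_cancel_of_le]
        rw [Finsupp.single_le_iff]; omega⟩
    have hβ := ih β (by simp at hn; omega)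
    have h1 := finrank_colorPiece_update hx β
    have h2 := finrank_colorPiece_update hx' β
    have h3 := h (Finsupp.single i 1 + β)
    omega

omit [Fintype ι] in
theorem finrank_update_sup {i : ι} {x : τ → k} (hx : x ∉ U i) (j : ι) :
    Module.finrank k (Function.update U i (U i ⊔ k ∙ x) j) =
      Function.update (fun j => Module.finrank k (U j)) i (Module.finrank k (U i) + 1) j := by
  by_cases hj : j = i
  · subst hj
    rw [Function.update_self, Function.update_self, Submodule.finrank_sup_span_singleton hx]
  · rw [Function.update_of_ne hj, Function.update_of_ne hj]

theorem sum_codim_update_lt {i : ι} {x : τ → k} (hx : x ∉ U i) :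
    ∑ j, (Fintype.card τ - Module.finrank k (Function.update U i (U i ⊔ k ∙ x) j)) <
      ∑ j, (Fintype.card τ - Module.finrank k (U j)) := by
  have hle : Module.finrank k (U i) + 1 ≤ Fintype.card τ := by
    rw [← Submodule.finrank_sup_span_singleton hx, ← Module.finrank_fintype_fun_eq_card k]
    exact Submodule.finrank_le _
  simp_rw [finrank_update_sup hx]
  refine Finset.sum_lt_sum (fun j _ => ?_) ⟨i, Finset.mem_univ i, ?_⟩
  · by_cases hj : j = i
    · subst hj; rw [Function.update_self]; omega
    · rw [Function.update_of_ne hj]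
  · rw [Function.update_self]; omega

theorem exists_notMem_of_finrank_eq {W W' : Submodule k (τ → k)}
    (h : Module.finrank k W = Module.finrank k W') (hW : W ≠ ⊤) : (∃ x, x ∉ W) ∧ ∃ x, x ∉ W' := by
  have hW' : W' ≠ ⊤ := fun h' => hW (Submodule.eq_top_of_finrank_eq (by rw [h, h', finrank_top]))
  simpa only [ne_eq, Submodule.eq_top_iff', not_forall] using And.intro hW hW'

theorem prodIdeal_empty : prodIdeal V Q ∅ = ⊤ := by
  rw [prodIdeal, Finset.prod_empty]
  exact eq_top_iff.2 fun x _ => Ideal.mem_sup_left (by simp)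

theorem finrank_linIdeal_colorSub [CharZero k]
    (h : ∀ i, Module.finrank k (U i) = Module.finrank k (U' i))
    (α : ι →₀ ℕ) :
    Module.finrank k (colorPiece (fun _ : Unit => ⊥) U {()} α) =
      Module.finrank k (colorPiece (fun _ : Unit => ⊥) U' {()} α) := by
  induction hn : ∑ j, (Fintype.card τ - Module.finrank k (U j)) using Nat.strong_induction_on
    generalizing U U' α with
  | _ n ih =>
  by_cases hU : ∀ i, U i = ⊤
  · have hU' : ∀ i, U' i = ⊤ := fun i =>
      Submodule.eq_top_of_finrank_eq (by rw [← h, hU, finrank_top])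
    unfold colorPiece
    rw [colorSub_eq_top hU, colorSub_eq_top hU']
  · push Not at hU
    obtain ⟨i, hi⟩ := hU
    obtain ⟨⟨x, hx⟩, x', hx'⟩ := exists_notMem_of_finrank_eq (h i) hi
    refine finrank_colorPiece_eq_of_update (by simpa using hx) (by simpa using hx')
      (fun α => ih _ (hn ▸ sum_codim_update_lt hx) (fun j => ?_) α rfl) α
    rw [finrank_update_sup hx, finrank_update_sup hx', h i, funext h]

omit [DecidableEq ι] in
theorem colorPiece_eq_of_lt {α : ι →₀ ℕ} (hα : α.degree < A.card) :
    colorPiece L U A α = colorPiece (fun _ : Unit => ⊥) U {()} α := by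
  apply le_antisymm
  · rintro f ⟨hf, hfW⟩
    exact ⟨linIdeal_le_prodIdeal (mem_linIdeal_of_mem_prodIdeal (colorPart_le α hfW) hα hf), hfW⟩
  · rintro f ⟨hf, hfW⟩
    refine ⟨?_, hfW⟩
    refine (sup_le ?_ linIdeal_le_prodIdeal : prodIdeal _ _ _ ≤ prodIdeal _ _ _) hf
    rw [Finset.prod_singleton]
    refine linIdeal_le_iff.2 fun y hy => ?_
    have : y = 0 := funext fun s => congrFun ((Submodule.mem_bot k).1 (hy s.1)) s.2
    rw [this, map_zero]; exact zero_mem _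

theorem exists_cubeDiff_eq_color [CharZero k] [LinearOrder κ] (hA : A.Nonempty)
    (htop : ∀ i, A.sup L ⊔ U i = ⊤) {α : ι →₀ ℕ} (hα : A.card ≤ α.degree)
    (z : Finset κ → MvPolynomial (ι × τ) k)
    (hz : z ∈ cubeChains (fun j => colorSub fun _ => L j) (colorSub U) A
      (weightedHomogeneousSubmodule k (colorWeight : ι × τ → ι →₀ ℕ) α))
    (hdz : cubeDiff _ A z = 0) :
    ∃ u ∈ cubeChains (fun j => colorSub fun _ => L j) (colorSub U) A
      (weightedHomogeneousSubmodule k (colorWeight : ι × τ → ι →₀ ℕ) α), cubeDiff _ A u = z := by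
  obtain ⟨u, hu, hdu⟩ := exists_cubeDiff_eq (fun j => colorSub fun _ => L j) A hA (colorSub U)
    (by rw [sup_colorSub, colorSub_eq_top htop]) α.degree hα z
    (fun B => ⟨(hz B).1, colorPart_le α (hz B).2.1, (hz B).2.2⟩) hdz
  refine ⟨fun B => weightedHomogeneousComponent colorWeight α (u B), fun B => ⟨?_, ?_, ?_⟩, ?_⟩
  · exact weightedHomogeneousComponent_mem_of_mem _ _
      (isHomogeneous_prodIdeal_colorSub L U B) (hu B).1 α
  · exact weightedHomogeneousComponent_mem _ _ _
  · intro hB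
    change weightedHomogeneousComponent colorWeight α (u B) = 0
    rw [(hu B).2.2 hB, map_zero]
  · ext1 B
    rw [← IsWeightedHomogeneous.weightedHomogeneousComponent_same (hz B).2.1, ← hdu,
      cubeDiff_apply_apply, cubeDiff_apply_apply, map_sum]
    refine Finset.sum_congr rfl fun i _ => ?_
    split_ifs
    · rw [map_zero]
    · rcases neg_one_pow_eq_or (MvPolynomial (ι × τ) k) (B.filter (· < i)).card with h | h
      · rw [koszulSign, h, one_mul, one_mul]
      · rw [koszulSign, h, neg_one_mul, neg_one_mul, map_neg]

/-- The graded pieces of these ideals only depend on the rank functions. -/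
theorem finrank_colorPiece_eq [CharZero k]
    (hL : ∀ F : Finset κ, Module.finrank k (F.sup L : Submodule k (τ → k)) =
      Module.finrank k (F.sup L' : Submodule k (τ → k)))
    (A : Finset κ) (hU : ∀ i, Module.finrank k (U i) = Module.finrank k (U' i))
    (hd : ∀ i, Disjoint (A.sup L) (U i)) (hd' : ∀ i, Disjoint (A.sup L') (U' i)) (α : ι →₀ ℕ) :
    Module.finrank k (colorPiece L U A α) = Module.finrank k (colorPiece L' U' A α) := by
  classical
  induction A using Finset.strongInduction generalizing U U' α with
  | H A ihA =>
  induction hn : ∑ j, (Fintype.card τ - Module.finrank k (U j)) using Nat.strong_induction_on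
    generalizing U U' α with
  | _ n ih =>
  have hsum : ∀ i, Module.finrank k (A.sup L ⊔ U i : Submodule k (τ → k)) =
      Module.finrank k (A.sup L' ⊔ U' i : Submodule k (τ → k)) := fun i => by
    have h1 := Submodule.finrank_sup_add_finrank_inf_eq (A.sup L) (U i)
    have h2 := Submodule.finrank_sup_add_finrank_inf_eq (A.sup L') (U' i)
    rw [(hd i).eq_bot, finrank_bot] at h1
    rw [(hd' i).eq_bot, finrank_bot] at h2
    have := hL A
    have := hU i
    omega
  by_cases hspan : ∀ i, A.sup L ⊔ U i = ⊤
  swap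
  · push Not at hspan
    obtain ⟨i, hi⟩ := hspan
    obtain ⟨⟨x, hx⟩, x', hx'⟩ := exists_notMem_of_finrank_eq (hsum i) hi
    have hxU : x ∉ U i := fun h => hx (le_sup_right (a := A.sup L) h)
    have hxU' : x' ∉ U' i := fun h => hx' (le_sup_right (a := A.sup L') h)
    have hdis : ∀ {L : κ → Submodule k (τ → k)} {U : ι → Submodule k (τ → k)} {x : τ → k},
        x ∉ A.sup L ⊔ U i → (∀ i, Disjoint (A.sup L) (U i)) →
        ∀ j, Disjoint (A.sup L) (Function.update U i (U i ⊔ k ∙ x) j) := by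
      intro L U x hx h j
      by_cases hj : j = i
      · subst hj
        rw [Function.update_self]
        exact (h j).disjoint_sup_right_of_disjoint_sup_left
          (Submodule.disjoint_span_singleton_of_notMem hx)
      · rw [Function.update_of_ne hj]; exact h j
    refine finrank_colorPiece_eq_of_update hx hx'
      (fun α => ih _ (hn ▸ sum_codim_update_lt hxU) (fun j => ?_) (hdis hx hd) (hdis hx' hd')
        α rfl) α
    rw [finrank_update_sup hxU, finrank_update_sup hxU', hU i, funext hU]
  have hspan' : ∀ i, A.sup L' ⊔ U' i = ⊤ := fun i =>
    Submodule.eq_top_of_finrank_eq (by rw [← hsum, hspan, finrank_top])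
  rcases lt_or_ge α.degree A.card with hα | hα
  · rw [colorPiece_eq_of_lt hα, colorPiece_eq_of_lt hα]
    exact finrank_linIdeal_colorSub hU α
  rcases A.eq_empty_or_nonempty with rfl | hA
  · unfold colorPiece prodPiece
    rw [prodIdeal_empty, prodIdeal_empty]
  let _ : LinearOrder κ := linearOrderOfSTO (WellOrderingRel)
  have h1 := sum_neg_one_pow_finrank_prodPiece _ fun z =>
    exists_cubeDiff_eq_color (L := L) hA hspan hα z
  have h2 := sum_neg_one_pow_finrank_prodPiece _ fun z =>
    exists_cubeDiff_eq_color (L := L') hA hspan' hα z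
  rw [← Finset.sum_erase_add _ _ (Finset.mem_powerset_self A)] at h1 h2
  have h3 : ∀ B ∈ A.powerset.erase A,
      Module.finrank k (colorPiece L U B α) = Module.finrank k (colorPiece L' U' B α) :=
    fun B hB => by
      rw [Finset.mem_erase, Finset.mem_powerset] at hB
      exact ihA B (lt_of_le_of_ne hB.2 hB.1) hU (fun i => (hd i).mono_left (Finset.sup_mono hB.2))
        (fun i => (hd' i).mono_left (Finset.sup_mono hB.2)) α
  unfold colorPiece at h3 ⊢
  rw [Finset.sum_congr rfl fun B hB => by rw [h3 B hB]] at h1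
  have h4 := h1.trans h2.symm
  rw [add_right_inj, mul_right_inj' (pow_ne_zero _ (by norm_num))] at h4
  exact_mod_cast h4
end ColorPiece

/-- The number of times each value is taken by `b`. -/
def content {ι κ : Type*} [Fintype κ] (b : κ → ι) : ι →₀ ℕ := ∑ p, Finsupp.single (b p) 1

theorem content_apply {ι κ : Type*} [Fintype κ] [DecidableEq ι] (b : κ → ι) (i : ι) :
    content b i = (Finset.univ.filter fun p => b p = i).card := by
  rw [content, Finsupp.finsetSum_apply, Finset.card_filter]
  simp only [Finsupp.single_apply]

theorem degree_content {ι κ : Type*} [Fintype κ] (b : κ → ι) :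
    (content b).degree = Fintype.card κ := by
  rw [content, map_sum]
  simp

theorem content_comp {ι κ : Type*} [Fintype κ] (b : κ → ι) (τ : Equiv.Perm κ) :
    content (b ∘ τ) = content b :=
  Equiv.sum_comp τ fun p => Finsupp.single (b p) 1

theorem content_eq_iff {ι κ : Type*} [Fintype κ] {a b : κ → ι} :
    content a = content b ↔ ∃ τ : Equiv.Perm κ, a = b ∘ τ := by
  classical
  constructor
  · intro h
    have hc : ∀ i, Nonempty ({p // a p = i} ≃ {p // b p = i}) := fun i => by
      have h1 := content_apply a i
      have h2 := content_apply b i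
      rw [← Fintype.card_eq, Fintype.card_subtype, Fintype.card_subtype]
      rw [← h1, ← h2, h]
    refine ⟨Equiv.ofFiberEquiv fun i => (hc i).some, ?_⟩
    ext p
    exact (Equiv.ofFiberEquiv_map (fun i => (hc i).some) p).symm
  · rintro ⟨τ, rfl⟩
    exact content_comp b τ

section ColorSpan
variable {ι τ : Type*} [Fintype ι] [Fintype τ] [DecidableEq ι] [Fintype κ]

/-- The product of the linear forms given by the vectors `v j` in the colors `b j`. -/
def colorProd (v : κ → τ → k) (b : κ → ι) : MvPolynomial (ι × τ) k :=
  ∏ j, linForm (colorEmb (b j) (v j))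

theorem colorProd_mem (v : κ → τ → k) (b : κ → ι) : colorProd v b ∈
    weightedHomogeneousSubmodule k (colorWeight : ι × τ → ι →₀ ℕ) (content b) :=
  IsWeightedHomogeneous.prod _ _ _ fun j _ => linForm_colorEmb_mem (b j) (v j)

theorem isHomogeneous_colorProd (v : κ → τ → k) (b : κ → ι) :
    (colorProd v b).IsHomogeneous (Fintype.card κ) :=
  degree_content b ▸ colorPart_le _ (colorProd_mem v b)

theorem linIdeal_colorSub_span_singleton (x : τ → k) :
    linIdeal (colorSub fun _ : ι => k ∙ x) =
      Ideal.span (Set.range fun i : ι => linForm (colorEmb i x)) := by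
  refine le_antisymm (linIdeal_le_iff.2 fun y hy => ?_) ?_
  · rw [← sum_colorEmb y, map_sum]
    refine Ideal.sum_mem _ fun i _ => ?_
    obtain ⟨c, hc⟩ := Submodule.mem_span_singleton.1 (hy i)
    rw [← hc, map_smul, map_smul, Algebra.smul_def]
    exact Ideal.mul_mem_left _ _ (Ideal.subset_span ⟨i, rfl⟩)
  · rw [Ideal.span_le]
    rintro _ ⟨i, rfl⟩
    exact linForm_mem_linIdeal ((colorEmb_mem_iff (U := fun _ => k ∙ x)).2
      (Submodule.mem_span_singleton_self x))

theorem prod_linIdeal_colorSub (v : κ → τ → k) :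
    ∏ j, linIdeal (colorSub fun _ : ι => k ∙ v j) =
      Ideal.span (Set.range fun b : κ → ι => colorProd v b) := by
  simp only [linIdeal_colorSub_span_singleton]
  rw [Ideal.prod_span]
  congr 1
  ext f
  rw [Set.mem_fintype_prod]
  constructor
  · rintro ⟨g, hg, rfl⟩
    choose b hb using hg
    exact ⟨b, Finset.prod_congr rfl fun j _ => hb j⟩
  · rintro ⟨b, rfl⟩
    exact ⟨fun j => linForm (colorEmb (b j) (v j)), fun j => ⟨b j, rfl⟩, rfl⟩

theorem colorPiece_span_singleton (v : κ → τ → k) {α : ι →₀ ℕ} (hα : α.degree = Fintype.card κ) :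
    colorPiece (fun j => k ∙ v j) (fun _ : ι => ⊥) Finset.univ α =
      Submodule.span k {f | ∃ b : κ → ι, content b = α ∧ f = colorProd v b} := by
  classical
  have h0 : linIdeal (colorSub fun _ : ι => (⊥ : Submodule k (τ → k))) = ⊥ := by
    refine le_antisymm (linIdeal_le_iff.2 fun y hy => ?_) bot_le
    have : y = 0 := funext fun s => congrFun ((Submodule.mem_bot k).1 (hy s.1)) s.2
    rw [this, map_zero]
    exact zero_mem _
  apply le_antisymm
  · rintro f ⟨hf, hfα⟩
    have hf' : f ∈ Ideal.span (Set.range fun b : κ → ι => colorProd v b) := by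
      rw [← prod_linIdeal_colorSub]
      simpa [prodIdeal, h0] using hf
    obtain ⟨c, hc⟩ := (Ideal.mem_span_range_iff_exists_fun).1 hf'
    have hfn : f = ∑ b, coeff 0 (c b) • colorProd v b := by
      have h1 := DirectSum.decompose_of_mem_same (homogeneousSubmodule (ι × τ) k)
        (show f ∈ homogeneousSubmodule (ι × τ) k (0 + Fintype.card κ) by
          rw [zero_add, ← hα]; exact colorPart_le α hfα)
      rw [← h1]
      conv_lhs => rw [← hc]
      rw [DirectSum.decompose_sum, DFinsupp.finsetSum_apply, AddSubmonoidClass.coe_finsetSum]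
      refine Finset.sum_congr rfl fun b _ => ?_
      rw [DirectSum.coe_decompose_mul_add_of_right_mem (homogeneousSubmodule (ι × τ) k)
        (isHomogeneous_colorProd v b), smul_eq_C_mul, ← homogeneousComponent_zero]
      exact congrArg (· * colorProd v b) (decomposition.decompose'_apply (c b) 0)
    have h2 : f = weightedHomogeneousComponent (colorWeight : ι × τ → ι →₀ ℕ) α f := by
      rw [weightedHomogeneousComponent_of_mem hfα, if_pos rfl]
    rw [h2, hfn, map_sum]
    refine Submodule.sum_mem _ fun b _ => ?_
    rw [map_smul, weightedHomogeneousComponent_of_mem (colorProd_mem v b)]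
    refine Submodule.smul_mem _ _ ?_
    split_ifs with hb
    · exact Submodule.subset_span ⟨b, hb.symm, rfl⟩
    · exact zero_mem _
  · rw [Submodule.span_le]
    rintro _ ⟨b, rfl, rfl⟩
    refine ⟨?_, colorProd_mem v b⟩
    have : colorProd v b ∈ ∏ j, linIdeal (colorSub fun _ : ι => k ∙ v j) := by
      rw [prod_linIdeal_colorSub]
      exact Ideal.subset_span ⟨b, rfl⟩
    exact Ideal.mem_sup_left this

theorem finrank_span_colorProd_eq [CharZero k] {v v' : κ → τ → k}
    (h : ∀ F : Finset κ, Module.finrank k (Submodule.span k (v '' F)) =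
      Module.finrank k (Submodule.span k (v' '' F)))
    {α : ι →₀ ℕ} (hα : α.degree = Fintype.card κ) :
    Module.finrank k (Submodule.span k {f | ∃ b : κ → ι, content b = α ∧ f = colorProd v b}) =
      Module.finrank k
        (Submodule.span k {f | ∃ b : κ → ι, content b = α ∧ f = colorProd v' b}) := by
  have hs : ∀ (u : κ → τ → k) (F : Finset κ), (F.sup fun j => k ∙ u j) =
      Submodule.span k (u '' F) := fun u F => by
    rw [Finset.sup_eq_iSup, ← Set.biUnion_of_singleton (u '' F), Submodule.span_iUnion₂,
      iSup_image]
    rfl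
  rw [← colorPiece_span_singleton v hα, ← colorPiece_span_singleton v' hα]
  exact finrank_colorPiece_eq (fun F => by rw [hs, hs, h]) _ (fun _ => by simp)
    (fun _ => disjoint_bot_right) (fun _ => disjoint_bot_right) α

end ColorSpan

theorem finrank_span_image_le_of_linearIndepOn {E E' : Type*} [AddCommGroup E] [Module k E]
    [AddCommGroup E'] [Module k E'] {v : κ → E} {v' : κ → E'}
    (h : ∀ S : Finset κ, LinearIndepOn k v S → LinearIndepOn k v' S) (F : Finset κ) :
    Module.finrank k (Submodule.span k (v '' F)) ≤
      Module.finrank k (Submodule.span k (v' '' F)) := by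
  classical
  obtain ⟨S, hSF, -, hspan, hS⟩ := exists_linearIndepOn_extension (K := k) (v := v)
    (linearIndepOn_empty k v) (Set.empty_subset (F : Set κ))
  obtain ⟨S, rfl⟩ := (F.finite_toSet.subset hSF).exists_finset_coe
  have hle : Submodule.span k (v '' F) = Submodule.span k (v '' S) :=
    le_antisymm (Submodule.span_le.2 hspan) (Submodule.span_mono (Set.image_mono hSF))
  have hc : ∀ {E : Type _} [AddCommGroup E] [Module k E] {u : κ → E}, LinearIndepOn k u S →
      Module.finrank k (Submodule.span k (u '' S)) = S.card := fun {E} _ _ u hu => by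
    rw [Set.image_eq_range, finrank_span_eq_card hu]
    simp
  rw [hle, hc hS]
  have hS' := h S hS
  have : Module.Finite k (Submodule.span k (v' '' F)) :=
    Module.Finite.span_of_finite k (F.finite_toSet.image v')
  calc S.card = Module.finrank k (Submodule.span k (v' '' S)) := by
        rw [Set.image_eq_range, finrank_span_eq_card hS']
        simp
    _ ≤ _ := Submodule.finrank_mono (Submodule.span_mono (Set.image_mono hSF))

section SmulTrace
variable {k R : Type*} [Field k] [Ring R] [Algebra k R]

/-- The trace of the multiplication by an element of an algebra on a module. -/
def smulTrace (k : Type*) {R : Type*} [Field k] [Ring R] [Algebra k R] (N : Type*)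
    [AddCommGroup N] [Module k N] [Module R N] [IsScalarTower k R N] : R →ₗ[k] k :=
  LinearMap.trace k N ∘ₗ (Algebra.lsmul k k N).toLinearMap

theorem smulTrace_apply (N : Type*) [AddCommGroup N] [Module k N] [Module R N]
    [IsScalarTower k R N] (a : R) :
    smulTrace k N a = LinearMap.trace k N (Algebra.lsmul k k N a) := rfl

theorem smulTrace_congr {N N' : Type*} [AddCommGroup N] [Module k N] [Module R N]
    [IsScalarTower k R N] [AddCommGroup N'] [Module k N'] [Module R N'] [IsScalarTower k R N']
    (e : N ≃ₗ[R] N') : (smulTrace k N : R →ₗ[k] k) = smulTrace k N' := by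
  ext a
  rw [smulTrace_apply, smulTrace_apply, ← LinearMap.trace_conj' _ (e.restrictScalars k)]
  congr 1
  ext x
  simp [LinearEquiv.conj_apply]

theorem smulTrace_prod (N N' : Type*) [AddCommGroup N] [Module k N] [Module R N]
    [IsScalarTower k R N] [AddCommGroup N'] [Module k N'] [Module R N'] [IsScalarTower k R N']
    [Module.Finite k N] [Module.Finite k N'] (a : R) :
    smulTrace k (N × N') a = smulTrace k N a + smulTrace k N' a := by
  rw [smulTrace_apply, smulTrace_apply, smulTrace_apply, ← LinearMap.trace_prodMap']
  rfl

theorem smulTrace_one (N : Type*) [AddCommGroup N] [Module k N] [Module R N]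
    [IsScalarTower k R N] [Module.Finite k N] : smulTrace k N (1 : R) = Module.finrank k N := by
  rw [smulTrace_apply, map_one, LinearMap.trace_one]

theorem smulTrace_of_isIdempotentElem {N : Type*} [AddCommGroup N] [Module k N] [Module R N]
    [IsScalarTower k R N] [Module.Finite k N] {e : R} (he : IsIdempotentElem e) :
    smulTrace k N e = Module.finrank k (LinearMap.range (Algebra.lsmul k k N e)) := by
  rw [smulTrace_apply]
  refine LinearMap.IsProj.trace ⟨fun x => ⟨x, rfl⟩, ?_⟩
  rintro _ ⟨x, rfl⟩
  rw [← Module.End.mul_apply, ← map_mul, he.eq]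

theorem finite_submodule_of_tower {N : Type*} [AddCommGroup N] [Module k N] [Module R N]
    [IsScalarTower k R N] [Module.Finite k N] (W : Submodule R N) : Module.Finite k W :=
  Module.Finite.of_injective (W.subtype.restrictScalars k) W.subtype_injective

variable [IsSemisimpleRing R]

/-- A simple module over a semisimple ring is detected by an idempotent. -/
theorem IsSimpleModule.exists_idempotent (S : Type*) [AddCommGroup S] [Module R S]
    [IsSimpleModule R S] : ∃ e : R, IsIdempotentElem e ∧ (∃ s : S, e • s ≠ 0) ∧
      ∀ (N : Type*) [AddCommGroup N] [Module R N] (x : N), e • x ≠ 0 →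
        ∃ f : S →ₗ[R] N, Function.Injective f := by
  have := IsSimpleModule.nontrivial R S
  obtain ⟨s, hs⟩ := exists_ne (0 : S)
  set q := LinearMap.toSpanSingleton R S s with hq
  obtain ⟨J, hJ⟩ := exists_isCompl (LinearMap.ker q)
  obtain ⟨i, hi, e, he, hie⟩ := Submodule.mem_sup.1
    (hJ.sup_eq_top ▸ Submodule.mem_top : (1 : R) ∈ LinearMap.ker q ⊔ J)
  have hxe : ∀ x ∈ J, x * e = x := fun x hx => by
    have h1 : x - x * e = x * i := by rw [sub_eq_iff_eq_add, ← mul_add, hie, mul_one]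
    have h2 : x - x * e ∈ LinearMap.ker q ⊓ J :=
      ⟨h1 ▸ Submodule.smul_mem _ x hi, sub_mem hx (Submodule.smul_mem _ x he)⟩
    rw [hJ.inf_eq_bot] at h2
    exact (sub_eq_zero.1 ((Submodule.mem_bot R).1 h2)).symm
  have hes : e • s = s := by
    have h0 : i • s = 0 := hi
    have h1 := add_smul i e s
    rw [hie, one_smul, h0, zero_add] at h1
    exact h1.symm
  refine ⟨e, hxe e he, ⟨s, by rwa [hes]⟩, fun N _ _ x hx => ?_⟩
  let p : J →ₗ[R] S := q.domRestrict J
  have hp : Function.Bijective p := by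
    refine ⟨(injective_iff_map_eq_zero p).2 fun y hy => ?_, LinearMap.surjective_of_ne_zero ?_⟩
    · have : (y : R) ∈ LinearMap.ker q ⊓ J := ⟨hy, y.2⟩
      rw [hJ.inf_eq_bot] at this
      exact Subtype.ext ((Submodule.mem_bot R).1 this)
    · intro h
      have : p ⟨e, he⟩ = 0 := by rw [h, LinearMap.zero_apply]
      exact hs (hes.symm.trans this)
  let f : S →ₗ[R] N := (LinearMap.toSpanSingleton R N x).domRestrict J ∘ₗ
    (LinearEquiv.ofBijective p hp).symm.toLinearMap
  refine ⟨f, (LinearMap.injective_or_eq_zero f).resolve_right fun h => hx ?_⟩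
  have h1 : f (p ⟨e, he⟩) = e • x :=
    congrArg (fun y : J => (y : R) • x) ((LinearEquiv.ofBijective p hp).symm_apply_apply ⟨e, he⟩)
  rw [← h1, h, LinearMap.zero_apply]

/-- Over a semisimple algebra in characteristic zero, finite dimensional modules with the same
character are isomorphic. -/
theorem nonempty_linearEquiv_of_smulTrace_eq [CharZero k] (N N' : Type*)
    [AddCommGroup N] [Module k N] [Module R N] [IsScalarTower k R N] [Module.Finite k N]
    [AddCommGroup N'] [Module k N'] [Module R N'] [IsScalarTower k R N'] [Module.Finite k N']
    (h : (smulTrace k N : R →ₗ[k] k) = smulTrace k N') : Nonempty (N ≃ₗ[R] N') := by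
  induction hd : Module.finrank k N using Nat.strong_induction_on generalizing N N' with
  | _ d ih =>
  have hdim : Module.finrank k N = Module.finrank k N' := by
    have := LinearMap.congr_fun h 1
    rw [smulTrace_one, smulTrace_one] at this
    exact_mod_cast this
  rcases subsingleton_or_nontrivial N with hN | hN
  · have : Subsingleton N' := by
      rw [← Module.finrank_zero_iff (R := k), ← hdim, Module.finrank_zero_iff]
      exact hN
    exact ⟨0⟩
  obtain ⟨S, hS⟩ := IsSemisimpleModule.exists_simple_submodule R N
  obtain ⟨e, he, ⟨s, hs⟩, hlift⟩ := IsSimpleModule.exists_idempotent (R := R) S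
  have hne : ∃ x : N', e • x ≠ 0 := by
    by_contra! h0
    have h1 : (Algebra.lsmul k k N' e : Module.End k N') = 0 := LinearMap.ext h0
    have h2 := LinearMap.congr_fun h e
    rw [smulTrace_apply N', h1, map_zero, smulTrace_of_isIdempotentElem he, Nat.cast_eq_zero,
      Submodule.finrank_eq_zero, LinearMap.range_eq_bot] at h2
    exact hs (Subtype.ext (LinearMap.congr_fun h2 (s : N)))
  obtain ⟨x, hx⟩ := hne
  obtain ⟨f, hf⟩ := hlift N' x hx
  obtain ⟨T, hT⟩ := exists_isCompl S
  obtain ⟨T', hT'⟩ := exists_isCompl (LinearMap.range f)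
  have := finite_submodule_of_tower (k := k) S
  have := finite_submodule_of_tower (k := k) T
  have := finite_submodule_of_tower (k := k) (LinearMap.range f)
  have := finite_submodule_of_tower (k := k) T'
  have eS : S ≃ₗ[R] LinearMap.range f := LinearEquiv.ofInjective f hf
  have eN := S.prodEquivOfIsCompl T hT
  have eN' := (LinearMap.range f).prodEquivOfIsCompl T' hT'
  have hTT : (smulTrace k T : R →ₗ[k] k) = smulTrace k T' := by
    ext a
    have h1 := LinearMap.congr_fun h a
    rw [← smulTrace_congr eN, ← smulTrace_congr eN', smulTrace_prod, smulTrace_prod,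
      smulTrace_congr eS] at h1
    exact add_left_cancel h1
  have hlt : Module.finrank k T < d := by
    have h1 := (eN.restrictScalars k).finrank_eq
    rw [Module.finrank_prod] at h1
    have : Nontrivial S := IsSimpleModule.nontrivial R S
    have := Module.finrank_pos (R := k) (M := S)
    omega
  obtain ⟨eT⟩ := ih _ hlt T T' hTT rfl
  exact ⟨eN.symm.trans ((LinearEquiv.prodCongr eS eT).trans eN')⟩

end SmulTrace

section Perm
variable {κ : Type*} [Fintype κ] [DecidableEq κ]

open Equiv.Perm

theorem Equiv.Perm.cycleType_eq_of_sameCycle {τ τ' : Equiv.Perm κ}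
    (h : ∀ x y, τ.SameCycle x y ↔ τ'.SameCycle x y) : τ.cycleType = τ'.cycleType := by
  have himg : ∀ (ρ : Equiv.Perm κ) (s : Finset κ), s ∈ ρ.cycleFactorsFinset.image support ↔
      ∃ x, (∃ y, y ≠ x ∧ ρ.SameCycle x y) ∧ ∀ y, y ∈ s ↔ ρ.SameCycle x y := by
    intro ρ s
    rw [Finset.mem_image]
    constructor
    · rintro ⟨c, hc, rfl⟩
      obtain ⟨x, hx⟩ := (mem_cycleFactorsFinset_iff.1 hc).1.nonempty_support
      have hcx := cycle_is_cycleOf hx hc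
      have hx' : x ∈ ρ.support := mem_cycleFactorsFinset_support_le hc hx
      refine ⟨x, ⟨ρ x, mem_support.1 hx', sameCycle_apply_right.2 (SameCycle.refl _ _)⟩,
        fun y => ?_⟩
      rw [hcx, mem_support_cycleOf_iff]
      simp [hx']
    · rintro ⟨x, ⟨y, hyx, hy⟩, hs⟩
      have hx : x ∈ ρ.support := by
        rw [mem_support]
        intro h0
        exact hyx (hy.eq_of_left h0).symm
      refine ⟨ρ.cycleOf x, cycleOf_mem_cycleFactorsFinset_iff.2 hx, ?_⟩
      ext z
      rw [mem_support_cycleOf_iff, hs]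
      simp [hx]
  have hval : ∀ ρ : Equiv.Perm κ,
      ρ.cycleType = (ρ.cycleFactorsFinset.image support).val.map Finset.card := by
    intro ρ
    rw [Finset.image_val_of_injOn, Multiset.map_map]
    · rfl
    · intro c hc d hd hcd
      obtain ⟨x, hx⟩ := (mem_cycleFactorsFinset_iff.1 hc).1.nonempty_support
      rw [cycle_is_cycleOf hx hc, cycle_is_cycleOf ((hcd ▸ hx : x ∈ d.support)) hd]
  rw [hval, hval]
  congr 2
  ext s
  rw [himg, himg]
  simp only [h]

/-- The permutations preserving a coloring. -/
def youngSubgroup {κ ι : Type*} (c : κ → ι) : Subgroup (Equiv.Perm κ) where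
  carrier := {τ | ∀ x, c (τ x) = c x}
  mul_mem' h h' x := (h _).trans (h' x)
  one_mem' _ := rfl
  inv_mem' {τ} h x := (h (τ⁻¹ x)).symm.trans (congrArg c (τ.apply_symm_apply x))

open Classical in
/-- A class function on a symmetric group whose sum over every Young subgroup vanishes is zero. -/
theorem eq_zero_of_sum_young_eq_zero {k : Type*} [Field k] [CharZero k] {D : Equiv.Perm κ → k}
    (hconj : ∀ τ τ', IsConj τ τ' → D τ = D τ')
    (hsum : ∀ c : κ → κ, ∑ τ ∈ Finset.univ.filter (· ∈ youngSubgroup c), D τ = 0)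
    (τ : Equiv.Perm κ) :
    D τ = 0 := by
  let P : Equiv.Perm κ → Finset (κ × κ) := fun ρ => Finset.univ.filter fun p => ρ.SameCycle p.1 p.2
  have hP : ∀ ρ x y, (x, y) ∈ P ρ ↔ ρ.SameCycle x y := fun ρ x y => by simp [P]
  induction hm : (P τ).card using Nat.strong_induction_on generalizing τ with
  | _ m ih =>
  let c : κ → κ := fun x => (Quotient.mk (SameCycle.setoid τ) x).out
  have hc : ∀ x y, c x = c y ↔ τ.SameCycle x y := fun x y => by
    rw [Quotient.out_inj, Quotient.eq]
    rfl
  have hle : ∀ ρ : Equiv.Perm κ, ρ ∈ youngSubgroup c → P ρ ⊆ P τ := by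
    rintro ρ hρ ⟨x, y⟩ hxy
    rw [hP] at hxy ⊢
    obtain ⟨i, rfl⟩ := hxy
    exact (hc _ _).1 ((youngSubgroup c).zpow_mem hρ i x).symm
  have hterm : ∀ ρ ∈ Finset.univ.filter (· ∈ youngSubgroup c),
      D ρ = if P ρ = P τ then D τ else 0 := by
    intro ρ hρ
    have hρ := (Finset.mem_filter.1 hρ).2
    split_ifs with h
    · refine hconj _ _ (isConj_iff_cycleType_eq.2 (cycleType_eq_of_sameCycle fun x y => ?_))
      rw [← hP, h, hP]
    · exact ih _ (hm ▸ Finset.card_lt_card ((hle ρ hρ).ssubset_of_ne h)) ρ rfl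
  have h0 := hsum c
  rw [Finset.sum_congr rfl hterm, ← Finset.sum_filter, Finset.sum_const, nsmul_eq_mul,
    mul_eq_zero, Nat.cast_eq_zero, Finset.card_eq_zero] at h0
  refine h0.resolve_left (Finset.ne_empty_of_mem (a := τ) ?_)
  simp only [Finset.mem_filter, Finset.mem_univ, true_and, and_true]
  exact fun x => (hc _ _).2 (sameCycle_apply_left.2 (SameCycle.refl _ _))

end Perm

end LinearForms

section SymmetricGroup

open MvPolynomial

variable {k κ : Type*} [Field k]

section PermRep
variable {ι t : Type*} [Fintype t] [Fintype κ]

variable (k t) in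
/-- The permutation of the factors of a tensor power of `k ^ t`. -/
def permMap (τ : Equiv.Perm κ) : Module.End k (⨂[k] _ : κ, (t → k)) :=
  (PiTensorProduct.reindex k (fun _ => t → k) τ).toLinearMap

omit [Fintype t] [Fintype κ] in
theorem permMap_tprod (τ : Equiv.Perm κ) (u : κ → t → k) :
    permMap k t τ (PiTensorProduct.tprod k u) = PiTensorProduct.tprod k (u ∘ τ.symm) :=
  PiTensorProduct.reindex_tprod τ u

variable (k κ t) in
/-- The representation of the symmetric group on a tensor power of `k ^ t`. -/
def permRep : Representation k (Equiv.Perm κ) (⨂[k] _ : κ, (t → k)) where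
  toFun := permMap k t
  map_one' := PiTensorProduct.ext (MultilinearMap.ext fun u => permMap_tprod 1 u)
  map_mul' τ τ' := PiTensorProduct.ext (MultilinearMap.ext fun u => by
    simp only [LinearMap.compMultilinearMap_apply, Module.End.mul_apply, permMap_tprod]
    rfl)

omit [Fintype t] [Fintype κ] in
theorem permRep_tprod (τ : Equiv.Perm κ) (u : κ → t → k) :
    permRep k κ t τ (PiTensorProduct.tprod k u) = PiTensorProduct.tprod k (u ∘ τ.symm) :=
  permMap_tprod τ u

variable (k κ t) in
/-- The standard basis of a tensor power of `k ^ t`. -/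
def tensorBasis : Module.Basis (κ → t) k (⨂[k] _ : κ, (t → k)) :=
  Basis.piTensorProduct fun _ => Pi.basisFun k t

theorem tensorBasis_repr_tprod (u : κ → t → k) (s : κ → t) :
    (tensorBasis k κ t).repr (PiTensorProduct.tprod k u) s = ∏ i, u i (s i) := by
  rw [tensorBasis, Basis.piTensorProduct_repr_tprod_apply]
  simp

theorem tensorBasis_apply [DecidableEq t] (s : κ → t) :
    tensorBasis k κ t s = PiTensorProduct.tprod k fun p => Pi.single (s p) 1 := by
  rw [tensorBasis, Basis.piTensorProduct_apply]
  simp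

theorem tensorBasis_repr_permRep (τ : Equiv.Perm κ) (x : ⨂[k] _ : κ, (t → k)) (s : κ → t) :
    (tensorBasis k κ t).repr (permRep k κ t τ x) s = (tensorBasis k κ t).repr x (s ∘ τ) := by
  have h : ((tensorBasis k κ t).coord s) ∘ₗ permRep k κ t τ =
      (tensorBasis k κ t).coord (s ∘ τ) := by
    refine PiTensorProduct.ext (MultilinearMap.ext fun u => ?_)
    simp only [LinearMap.compMultilinearMap_apply, LinearMap.comp_apply, permRep_tprod,
      Module.Basis.coord_apply, tensorBasis_repr_tprod]
    refine (Equiv.prod_comp τ _).symm.trans (Finset.prod_congr rfl fun i _ => ?_)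
    simp
  exact LinearMap.congr_fun h x

theorem prod_X_eq_monomial {α : Type*} (a : κ → α) :
    ∏ p, (X (a p) : MvPolynomial α k) = monomial (content a) 1 := by
  rw [content, monomial_sum_one]
  rfl

variable [Fintype ι] [DecidableEq ι]

variable (k t) in
/-- The linear map sending `⨂ u p` to the product of the linear forms `u p` in the colors `c p`. -/
def colorMap (c : κ → ι) : (⨂[k] _ : κ, (t → k)) →ₗ[k] MvPolynomial (ι × t) k :=
  PiTensorProduct.lift ((MultilinearMap.mkPiAlgebra k κ (MvPolynomial (ι × t) k)).compLinearMap
    fun p => linForm ∘ₗ colorEmb (c p))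

theorem colorMap_tprod (c : κ → ι) (u : κ → t → k) :
    colorMap k t c (PiTensorProduct.tprod k u) = colorProd u c := by
  simp [colorMap, colorProd]

theorem colorMap_permRep (c : κ → ι) (τ : Equiv.Perm κ) (x : ⨂[k] _ : κ, (t → k)) :
    colorMap k t c (permRep k κ t τ x) = colorMap k t (c ∘ τ) x := by
  have h : colorMap k t c ∘ₗ permRep k κ t τ = colorMap k t (c ∘ τ) := by
    refine PiTensorProduct.ext (MultilinearMap.ext fun u => ?_)
    simp only [LinearMap.compMultilinearMap_apply, LinearMap.comp_apply, permRep_tprod,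
      colorMap_tprod, colorProd]
    refine (Equiv.prod_comp τ _).symm.trans (Finset.prod_congr rfl fun i _ => ?_)
    simp
  exact LinearMap.congr_fun h x

theorem colorMap_tensorBasis (c : κ → ι) (s : κ → t) :
    colorMap k t c (tensorBasis k κ t s) = monomial (content fun p => (c p, s p)) 1 := by
  classical
  rw [tensorBasis_apply, colorMap_tprod, colorProd, ← prod_X_eq_monomial]
  refine Finset.prod_congr rfl fun p _ => ?_
  rw [← linForm_single]
  congr 1
  ext q
  rw [colorEmb_apply]
  by_cases h1 : q.1 = c p <;> by_cases h2 : q.2 = s p <;>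
    simp [h1, h2, Pi.single_apply, Prod.ext_iff]

/-- The map `colorMap c` is injective on the invariants of the Young subgroup of `c`. -/
theorem eq_zero_of_colorMap_eq_zero [CharZero k] {c : κ → ι} {x : ⨂[k] _ : κ, (t → k)}
    (hx : ∀ τ ∈ youngSubgroup c, permRep k κ t τ x = x) (h : colorMap k t c x = 0) : x = 0 := by
  classical
  refine (tensorBasis k κ t).ext_elem fun s => ?_
  rw [map_zero, Finsupp.zero_apply]
  rw [← (tensorBasis k κ t).sum_repr x, map_sum] at h
  have h1 := congrArg (coeff (content fun p => (c p, s p))) h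
  simp only [map_smul, colorMap_tensorBasis, coeff_sum, coeff_smul, coeff_monomial, coeff_zero,
    smul_eq_mul, mul_ite, mul_one, mul_zero] at h1
  have h2 : ∀ s' : κ → t, (if (content fun p => (c p, s' p)) = content fun p => (c p, s p) then
      (tensorBasis k κ t).repr x s' else 0) =
      if (content fun p => (c p, s' p)) = content fun p => (c p, s p) then
      (tensorBasis k κ t).repr x s else 0 := by
    intro s'
    split_ifs with hs
    · obtain ⟨τ, hτ⟩ := content_eq_iff.1 hs
      have hc : τ ∈ youngSubgroup c := fun p => (congrArg Prod.fst (congrFun hτ p)).symm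
      have hs' : s' = s ∘ τ := funext fun p => congrArg Prod.snd (congrFun hτ p)
      rw [hs', ← tensorBasis_repr_permRep, hx τ hc]
    · rfl
  rw [Finset.sum_congr rfl fun s' _ => h2 s', ← Finset.sum_filter, Finset.sum_const, nsmul_eq_mul,
    mul_eq_zero, Nat.cast_eq_zero, Finset.card_eq_zero] at h1
  exact h1.resolve_left (Finset.ne_empty_of_mem (a := s) (by simp))

end PermRep

section Commutant
variable {t : Type*} [Fintype t] [DecidableEq t] [Fintype κ] [DecidableEq κ]

theorem toMatrix_map_mulVecLin (g : Matrix t t k) (I J : κ → t) :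
    LinearMap.toMatrix (tensorBasis k κ t) (tensorBasis k κ t)
      (PiTensorProduct.map fun _ => g.mulVecLin) I J = ∏ p, g (I p) (J p) := by
  rw [LinearMap.toMatrix_apply, tensorBasis_apply, PiTensorProduct.map_tprod,
    tensorBasis_repr_tprod]
  simp

theorem toMatrix_comp_perm {T : Module.End k (⨂[k] _ : κ, (t → k))}
    (hT : ∀ (τ : Equiv.Perm κ) x, T (permRep k κ t τ x) = permRep k κ t τ (T x))
    (τ : Equiv.Perm κ) (I J : κ → t) :
    LinearMap.toMatrix (tensorBasis k κ t) (tensorBasis k κ t) T (I ∘ τ) (J ∘ τ) =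
      LinearMap.toMatrix (tensorBasis k κ t) (tensorBasis k κ t) T I J := by
  rw [LinearMap.toMatrix_apply, LinearMap.toMatrix_apply, ← tensorBasis_repr_permRep, ← hT,
    tensorBasis_apply, tensorBasis_apply, permRep_tprod]
  congr 4
  ext p
  simp

/-- Endomorphisms of a tensor power commuting with the permutations of the factors are linear
combinations of tensor powers of invertible matrices. -/
theorem mem_span_map_mulVecLin [CharZero k] {T : Module.End k (⨂[k] _ : κ, (t → k))}
    (hT : ∀ (τ : Equiv.Perm κ) x, T (permRep k κ t τ x) = permRep k κ t τ (T x)) :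
    T ∈ Submodule.span k (Set.range fun g : (Matrix t t k)ˣ =>
      (PiTensorProduct.map fun _ => g.1.mulVecLin : Module.End k (⨂[k] _ : κ, (t → k)))) := by
  by_contra hTm
  obtain ⟨φ, hφT, hφ⟩ := Submodule.exists_le_ker_of_notMem (K := k)
    (V := Module.End k (⨂[k] _ : κ, (t → k))) hTm
  apply hφT
  set B := tensorBasis k κ t
  let M : Module.End k (⨂[k] _ : κ, (t → k)) → (κ → t) → (κ → t) → k := fun S I J =>
    LinearMap.toMatrix B B S I J
  let φ' : (κ → t) → (κ → t) → k := fun I J => φ (Matrix.toLin B B (Matrix.single I J 1))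
  have hexp : ∀ S, φ S = ∑ I, ∑ J, M S I J * φ' I J := fun S => by
    conv_lhs => rw [← Matrix.toLin_toMatrix B B S, Matrix.matrix_eq_sum_single
      (LinearMap.toMatrix B B S)]
    simp only [map_sum]
    refine Finset.sum_congr rfl fun I _ => Finset.sum_congr rfl fun J _ => ?_
    rw [← mul_one (LinearMap.toMatrix B B S I J), ← smul_eq_mul, ← Matrix.smul_single, map_smul,
      map_smul, smul_eq_mul]
  let P : MvPolynomial (t × t) k :=
    ∑ I, ∑ J, monomial (content fun p : κ => (I p, J p)) (φ' I J)
  have heval : ∀ g : t × t → k, eval g P =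
      φ (PiTensorProduct.map fun _ => (Matrix.of fun i j => g (i, j)).mulVecLin) := fun g => by
    rw [hexp, map_sum]
    refine Finset.sum_congr rfl fun I _ => ?_
    rw [map_sum]
    refine Finset.sum_congr rfl fun J _ => ?_
    have h1 : monomial (content fun p : κ => (I p, J p)) (φ' I J) =
        C (φ' I J) * ∏ p, X (I p, J p) := by
      rw [prod_X_eq_monomial, C_mul_monomial, mul_one]
    rw [h1, map_mul, eval_C, map_prod, mul_comm]
    simp only [eval_X, M, B]
    rw [toMatrix_map_mulVecLin]
    rfl
  have hP : P = 0 := by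
    have h0 : P * (Matrix.mvPolynomialX t t k).det = 0 := by
      refine MvPolynomial.funext fun g => ?_
      rw [map_mul, map_zero, RingHom.map_det]
      have hg : (eval g).mapMatrix (Matrix.mvPolynomialX t t k) =
          Matrix.of fun i j => g (i, j) := by
        ext i j
        simp
      rw [hg]
      by_cases hd : (Matrix.of fun i j => g (i, j)).det = 0
      · rw [hd, mul_zero]
      · rw [heval]
        have := hφ (Submodule.subset_span ⟨Matrix.nonsingInvUnit _ (isUnit_iff_ne_zero.2 hd), rfl⟩)
        rw [LinearMap.mem_ker] at this
        erw [this, zero_mul]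
    exact (mul_eq_zero.1 h0).resolve_right (Matrix.det_mvPolynomialX_ne_zero t k)
  have hfac : (fun a : κ → t × t => M T (fun p => (a p).1) fun p => (a p).2).FactorsThrough
      content := fun a b hab => by
    obtain ⟨τ, rfl⟩ := content_eq_iff.1 hab
    exact toMatrix_comp_perm hT τ (fun p => (b p).1) fun p => (b p).2
  let ψ : MvPolynomial (t × t) k →ₗ[k] k := (basisMonomials (t × t) k).constr k
    (Function.extend content (fun a : κ → t × t => M T (fun p => (a p).1) fun p => (a p).2) 0)
  have hψ : ψ P = φ T := by
    rw [hexp, map_sum]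
    refine Finset.sum_congr rfl fun I _ => ?_
    rw [map_sum]
    refine Finset.sum_congr rfl fun J _ => ?_
    have h1 : monomial (content fun p : κ => (I p, J p)) (φ' I J) =
        φ' I J • basisMonomials (t × t) k (content fun p : κ => (I p, J p)) := by
      rw [coe_basisMonomials, smul_monomial, smul_eq_mul, mul_one]
    rw [h1, map_smul, Module.Basis.constr_basis, hfac.extend_apply, smul_eq_mul, mul_comm]
  rw [← hψ, hP, map_zero]

end Commutant

section Cyclic
variable {t : Type*} [Fintype t] [Fintype κ]

variable (k κ t) in
/-- A tensor power of `k ^ t` as a module over the group algebra of the symmetric group. -/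
abbrev PermTensor : Type _ := (permRep k κ t).asModule

instance : AddCommGroup (PermTensor k κ t) := Module.addCommMonoidToAddCommGroup k

/-- The cyclic module over the group algebra of the symmetric group generated by `⨂ u p`. -/
def cyclicMod (u : κ → t → k) : Submodule (MonoidAlgebra k (Equiv.Perm κ)) (PermTensor k κ t) :=
  Submodule.span _ {(permRep k κ t).asModuleEquiv.symm (PiTensorProduct.tprod k u)}

/-- The decomposable tensor `⨂ u p` as an element of the cyclic module it generates. -/
def cyclicGen (u : κ → t → k) : cyclicMod u :=
  ⟨(permRep k κ t).asModuleEquiv.symm (PiTensorProduct.tprod k u),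
    Submodule.mem_span_singleton_self _⟩

omit [Fintype t] [Fintype κ] in
theorem exists_smul_cyclicGen (u : κ → t → k) (x : cyclicMod u) :
    ∃ a : MonoidAlgebra k (Equiv.Perm κ), a • cyclicGen u = x := by
  obtain ⟨a, ha⟩ := Submodule.mem_span_singleton.1 x.2
  exact ⟨a, Subtype.ext ha⟩

instance : Module.Finite k (PermTensor k κ t) :=
  Module.Finite.of_basis ((tensorBasis k κ t).map (permRep k κ t).asModuleEquiv.symm)

instance (u : κ → t → k) : Module.Finite k (cyclicMod u) := finite_submodule_of_tower (k := k) _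

omit [Fintype t] [Fintype κ] in
theorem asModuleEquiv_single_smul (τ : Equiv.Perm κ) (x : PermTensor k κ t) :
    (permRep k κ t).asModuleEquiv ((MonoidAlgebra.single τ (1 : k)) • x) =
      permRep k κ t τ ((permRep k κ t).asModuleEquiv x) := by
  rw [Representation.asModuleEquiv_map_smul, Representation.asAlgebraHom_single, one_smul]

instance [CharZero k] [DecidableEq κ] : NeZero (Nat.card (Equiv.Perm κ) : k) :=
  ⟨Nat.cast_ne_zero.2 Nat.card_pos.ne'⟩

section Young
variable [DecidableEq κ]

open Classical in
variable (k) in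
/-- The averaging idempotent of the Young subgroup of a coloring. -/
def youngIdempotent {ι : Type*} (c : κ → ι) : MonoidAlgebra k (Equiv.Perm κ) :=
  ((Finset.univ.filter (· ∈ youngSubgroup c)).card : k)⁻¹ •
    ∑ τ ∈ Finset.univ.filter (· ∈ youngSubgroup c), MonoidAlgebra.single τ (1 : k)

open Classical in
theorem single_mul_youngIdempotent {ι : Type*} {c : κ → ι} {τ : Equiv.Perm κ}
    (hτ : τ ∈ youngSubgroup c) :
    MonoidAlgebra.single τ (1 : k) * youngIdempotent k c = youngIdempotent k c := by
  rw [youngIdempotent, mul_smul_comm, Finset.mul_sum]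
  congr 1
  refine Finset.sum_bij (fun ρ _ => τ * ρ) (fun ρ hρ => ?_) (fun _ _ _ _ h => mul_left_cancel h)
    (fun ρ hρ => ⟨τ⁻¹ * ρ, ?_, mul_inv_cancel_left τ ρ⟩) fun ρ _ => ?_
  · simp only [Finset.mem_filter, Finset.mem_univ, true_and] at hρ ⊢
    exact mul_mem hτ hρ
  · simp only [Finset.mem_filter, Finset.mem_univ, true_and] at hρ ⊢
    exact mul_mem (inv_mem hτ) hρ
  · rw [MonoidAlgebra.single_mul_single, one_mul]

open Classical in
theorem card_youngSubgroup_ne_zero [CharZero k] {ι : Type*} (c : κ → ι) :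
    ((Finset.univ.filter (· ∈ youngSubgroup c)).card : k) ≠ 0 :=
  Nat.cast_ne_zero.2 (Finset.card_ne_zero_of_mem (a := 1) (by simp [one_mem]))

theorem isIdempotentElem_youngIdempotent [CharZero k] {ι : Type*} (c : κ → ι) :
    IsIdempotentElem (youngIdempotent k c) := by
  classical
  rw [IsIdempotentElem]
  conv_lhs => lhs; rw [youngIdempotent]
  rw [smul_mul_assoc, Finset.sum_mul,
    Finset.sum_congr rfl fun τ hτ => single_mul_youngIdempotent (Finset.mem_filter.1 hτ).2,
    Finset.sum_const, ← Nat.cast_smul_eq_nsmul k, smul_smul,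
    inv_mul_cancel₀ (card_youngSubgroup_ne_zero c), one_smul]

variable {ι : Type*} [Fintype ι] [DecidableEq ι]

/-- The restriction of `colorMap c` to a cyclic module. -/
def cyclicColorMap (u : κ → t → k) (c : κ → ι) : cyclicMod u →ₗ[k] MvPolynomial (ι × t) k :=
  colorMap k t c ∘ₗ (permRep k κ t).asModuleEquiv.toLinearMap ∘ₗ
    (cyclicMod u).subtype.restrictScalars k

omit [DecidableEq κ] in
theorem cyclicColorMap_apply (u : κ → t → k) (c : κ → ι) (x : cyclicMod u) :
    cyclicColorMap u c x = colorMap k t c ((permRep k κ t).asModuleEquiv x.1) := rfl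

omit [DecidableEq κ] in
theorem cyclicColorMap_single_smul (u : κ → t → k) (c : κ → ι) (τ : Equiv.Perm κ)
    (x : cyclicMod u) :
    cyclicColorMap u c (MonoidAlgebra.single τ (1 : k) • x) = cyclicColorMap u (c ∘ τ) x := by
  rw [cyclicColorMap_apply, Submodule.coe_smul, asModuleEquiv_single_smul, colorMap_permRep]
  rfl

omit [DecidableEq κ] in
theorem cyclicColorMap_single_smul_cyclicGen (u : κ → t → k) (c : κ → ι) (τ : Equiv.Perm κ) :
    cyclicColorMap u c (MonoidAlgebra.single τ (1 : k) • cyclicGen u) = colorProd u (c ∘ τ) := by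
  rw [cyclicColorMap_single_smul, cyclicColorMap_apply, cyclicGen, LinearEquiv.apply_symm_apply,
    colorMap_tprod]

omit [DecidableEq κ] in
theorem range_cyclicColorMap (u : κ → t → k) (c : κ → ι) :
    LinearMap.range (cyclicColorMap u c) =
      Submodule.span k {f | ∃ b : κ → ι, content b = content c ∧ f = colorProd u b} := by
  apply le_antisymm
  · rintro _ ⟨x, rfl⟩
    obtain ⟨a, rfl⟩ := exists_smul_cyclicGen u x
    induction a using MonoidAlgebra.induction_linear with
    | zero => rw [zero_smul, map_zero]; exact zero_mem _
    | add a b ha hb => rw [add_smul, map_add]; exact add_mem ha hb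
    | single τ a =>
      rw [← mul_one a, ← smul_eq_mul, ← MonoidAlgebra.smul_single, smul_assoc, map_smul,
        cyclicColorMap_single_smul_cyclicGen]
      exact Submodule.smul_mem _ _ (Submodule.subset_span ⟨_, content_eq_iff.2 ⟨τ, rfl⟩, rfl⟩)
  · rw [Submodule.span_le]
    rintro _ ⟨b, hb, rfl⟩
    obtain ⟨τ, rfl⟩ := content_eq_iff.1 hb
    exact ⟨_, cyclicColorMap_single_smul_cyclicGen u c τ⟩

theorem cyclicColorMap_youngIdempotent_smul [CharZero k] (u : κ → t → k) (c : κ → ι)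
    (x : cyclicMod u) : cyclicColorMap u c (youngIdempotent k c • x) = cyclicColorMap u c x := by
  classical
  rw [youngIdempotent, smul_assoc, map_smul, Finset.sum_smul, map_sum, Finset.sum_congr rfl
    (g := fun _ => cyclicColorMap u c x), Finset.sum_const, ← Nat.cast_smul_eq_nsmul k, smul_smul,
    inv_mul_cancel₀ (card_youngSubgroup_ne_zero c), one_smul]
  intro τ hτ
  rw [cyclicColorMap_single_smul, show c ∘ τ = c from _root_.funext (Finset.mem_filter.1 hτ).2]

theorem smulTrace_youngIdempotent [CharZero k] (u : κ → t → k) (c : κ → ι) :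
    smulTrace k (cyclicMod u) (youngIdempotent k c) = Module.finrank k
      (Submodule.span k {f | ∃ b : κ → ι, content b = content c ∧ f = colorProd u b}) := by
  rw [smulTrace_of_isIdempotentElem (isIdempotentElem_youngIdempotent c), ← range_cyclicColorMap]
  set E := Algebra.lsmul k k (cyclicMod u) (youngIdempotent k c)
  have hinj : Function.Injective ((cyclicColorMap u c).domRestrict (LinearMap.range E)) := by
    rw [injective_iff_map_eq_zero]
    rintro ⟨_, x, rfl⟩ hx
    refine Subtype.ext (Subtype.ext ((permRep k κ t).asModuleEquiv.injective ?_))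
    refine (eq_zero_of_colorMap_eq_zero (fun τ hτ => ?_) hx).trans (map_zero _).symm
    change permRep k κ t τ ((permRep k κ t).asModuleEquiv (youngIdempotent k c • x.1)) =
      (permRep k κ t).asModuleEquiv (youngIdempotent k c • x.1)
    rw [← asModuleEquiv_single_smul, ← mul_smul, single_mul_youngIdempotent hτ]
  have hmap : (LinearMap.range E).map (cyclicColorMap u c) =
      LinearMap.range (cyclicColorMap u c) := by
    apply le_antisymm
    · exact LinearMap.map_le_range
    · rintro _ ⟨x, rfl⟩
      exact ⟨E x, ⟨x, rfl⟩, cyclicColorMap_youngIdempotent_smul u c x⟩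
  rw [← LinearMap.finrank_range_of_inj hinj, LinearMap.range_domRestrict, hmap]

omit [DecidableEq κ] [Fintype t] [Fintype κ] in
theorem smulTrace_single_of_isConj (u : κ → t → k) {τ τ' : Equiv.Perm κ} (h : IsConj τ τ') :
    smulTrace k (cyclicMod u) (MonoidAlgebra.single τ (1 : k)) =
      smulTrace k (cyclicMod u) (MonoidAlgebra.single τ' (1 : k)) := by
  obtain ⟨ρ, rfl⟩ := isConj_iff.1 h
  have h1 : MonoidAlgebra.single (ρ * τ * ρ⁻¹) (1 : k) = MonoidAlgebra.single ρ 1 *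
      MonoidAlgebra.single (τ * ρ⁻¹) 1 := by
    rw [MonoidAlgebra.single_mul_single, one_mul, mul_assoc]
  have h2 : MonoidAlgebra.single τ (1 : k) = MonoidAlgebra.single (τ * ρ⁻¹) 1 *
      MonoidAlgebra.single ρ 1 := by
    rw [MonoidAlgebra.single_mul_single, one_mul, inv_mul_cancel_right]
  rw [smulTrace_apply, smulTrace_apply, h1, h2, map_mul (Algebra.lsmul k k _),
    map_mul (Algebra.lsmul k k _), LinearMap.trace_mul_comm]

/-- Cyclic modules generated by decomposable tensors with the same rank function are isomorphic. -/
theorem nonempty_cyclicMod_linearEquiv [CharZero k] {u u' : κ → t → k}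
    (h : ∀ F : Finset κ, Module.finrank k (Submodule.span k (u '' F)) =
      Module.finrank k (Submodule.span k (u' '' F))) :
    Nonempty (cyclicMod u ≃ₗ[MonoidAlgebra k (Equiv.Perm κ)] cyclicMod u') := by
  classical
  refine nonempty_linearEquiv_of_smulTrace_eq (k := k) _ _ ?_
  have hD := eq_zero_of_sum_young_eq_zero (D := fun τ : Equiv.Perm κ =>
    smulTrace k (cyclicMod u) (MonoidAlgebra.single τ (1 : k)) -
      smulTrace k (cyclicMod u') (MonoidAlgebra.single τ (1 : k)))
    (fun τ τ' hτ => by simp only [smulTrace_single_of_isConj _ hτ]) fun c => by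
      have h1 : (smulTrace k (cyclicMod u) - smulTrace k (cyclicMod u') :
          MonoidAlgebra k (Equiv.Perm κ) →ₗ[k] k) (youngIdempotent k c) = 0 := by
        rw [LinearMap.sub_apply, smulTrace_youngIdempotent, smulTrace_youngIdempotent,
          finrank_span_colorProd_eq h (degree_content c), sub_self]
      rw [youngIdempotent, map_smul, smul_eq_zero] at h1
      simpa only [map_sum, LinearMap.sub_apply] using
        h1.resolve_left (inv_ne_zero (card_youngSubgroup_ne_zero c))
  refine LinearMap.ext fun a => ?_
  induction a using MonoidAlgebra.induction_linear with
  | zero => rw [map_zero, map_zero]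
  | add a b ha hb => rw [map_add, map_add, ha, hb]
  | single τ a =>
    rw [← mul_one a, ← smul_eq_mul, ← MonoidAlgebra.smul_single, map_smul, map_smul,
      sub_eq_zero.1 (hD τ)]

end Young

end Cyclic

section Orbit
variable {t : Type*} [Fintype t] [DecidableEq t] [Fintype κ]

omit [DecidableEq t] [Fintype κ] in
theorem map_mulVecLin_mul (g h : Matrix t t k) :
    (PiTensorProduct.map fun _ => (g * h).mulVecLin : Module.End k (⨂[k] _ : κ, (t → k))) =
      (PiTensorProduct.map fun _ => g.mulVecLin) ∘ₗ PiTensorProduct.map fun _ => h.mulVecLin := by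
  rw [← PiTensorProduct.map_comp]
  simp only [Matrix.mulVecLin_mul]

omit [DecidableEq t] [Fintype κ] in
theorem map_mulVecLin_asAlgebraHom (g : Matrix t t k) (a : MonoidAlgebra k (Equiv.Perm κ))
    (x : ⨂[k] _ : κ, (t → k)) :
    PiTensorProduct.map (fun _ => g.mulVecLin) ((permRep k κ t).asAlgebraHom a x) =
      (permRep k κ t).asAlgebraHom a (PiTensorProduct.map (fun _ => g.mulVecLin) x) := by
  induction a using MonoidAlgebra.induction_linear with
  | zero => simp
  | add a b ha hb => simp only [map_add, LinearMap.add_apply, ha, hb]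
  | single τ a =>
    rw [Representation.asAlgebraHom_single, LinearMap.smul_apply, LinearMap.smul_apply, map_smul]
    congr 1
    have h : PiTensorProduct.map (fun _ => g.mulVecLin) ∘ₗ permRep k κ t τ =
        permRep k κ t τ ∘ₗ PiTensorProduct.map (fun _ => g.mulVecLin) := by
      refine PiTensorProduct.ext (MultilinearMap.ext fun u => ?_)
      simp only [LinearMap.compMultilinearMap_apply, LinearMap.comp_apply, permRep_tprod,
        PiTensorProduct.map_tprod]
      rfl
    exact LinearMap.congr_fun h x

/-- The span of the orbit of a decomposable tensor under the general linear group. -/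
def orbitSpan (u : κ → t → k) : Submodule k (⨂[k] _ : κ, (t → k)) :=
  Submodule.span k (Set.range fun g : (Matrix t t k)ˣ =>
    PiTensorProduct.map (fun _ => g.1.mulVecLin) (PiTensorProduct.tprod k u))

omit [Fintype κ] in
theorem map_mem_orbitSpan (g : (Matrix t t k)ˣ) {u : κ → t → k} {x : ⨂[k] _ : κ, (t → k)}
    (hx : x ∈ orbitSpan u) : PiTensorProduct.map (fun _ => g.1.mulVecLin) x ∈ orbitSpan u := by
  induction hx using Submodule.span_induction with
  | mem x hx =>
    obtain ⟨h, rfl⟩ := hx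
    refine Submodule.subset_span ⟨g * h, ?_⟩
    simp only [Units.val_mul, map_mulVecLin_mul, LinearMap.comp_apply]
  | zero => rw [map_zero]; exact zero_mem _
  | add x y _ _ hx hy => rw [map_add]; exact add_mem hx hy
  | smul a x _ hx => rw [map_smul]; exact Submodule.smul_mem _ _ hx

/-- A homomorphism of cyclic modules is induced by an element of the group algebra which also
maps the spans of the orbits to each other, in the opposite direction. -/
theorem exists_asAlgebraHom_mapsTo_orbitSpan [CharZero k] [DecidableEq κ] {u u' : κ → t → k}
    (Θ : cyclicMod u →ₗ[MonoidAlgebra k (Equiv.Perm κ)] cyclicMod u') :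
    ∃ a : MonoidAlgebra k (Equiv.Perm κ), a • cyclicGen u' = Θ (cyclicGen u) ∧
      ∀ x ∈ orbitSpan u', (permRep k κ t).asAlgebraHom a x ∈ orbitSpan u := by
  obtain ⟨a, ha⟩ := exists_smul_cyclicGen u' (Θ (cyclicGen u))
  refine ⟨a, ha, fun x hx => ?_⟩
  have hy : (permRep k κ t).asAlgebraHom a (PiTensorProduct.tprod k u') ∈ orbitSpan u := by
    obtain ⟨T, hT⟩ := IsSemisimpleModule.extension_property (cyclicMod u).subtype
      (cyclicMod u).subtype_injective ((cyclicMod u').subtype ∘ₗ Θ)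
    let T' : Module.End k (⨂[k] _ : κ, (t → k)) := (permRep k κ t).asModuleEquiv.toLinearMap ∘ₗ
      T.restrictScalars k ∘ₗ (permRep k κ t).asModuleEquiv.symm.toLinearMap
    have hT' : T' (PiTensorProduct.tprod k u) =
        (permRep k κ t).asAlgebraHom a (PiTensorProduct.tprod k u') := by
      have h1 := LinearMap.congr_fun hT (cyclicGen u)
      have h2 := congrArg Subtype.val ha
      exact congrArg (permRep k κ t).asModuleEquiv (h1.trans h2.symm)
    have hspan := mem_span_map_mulVecLin (T := T') fun τ x => by
      have h1 := asModuleEquiv_single_smul τ ((permRep k κ t).asModuleEquiv.symm x)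
      rw [LinearEquiv.apply_symm_apply, ← LinearEquiv.eq_symm_apply] at h1
      change (permRep k κ t).asModuleEquiv (T ((permRep k κ t).asModuleEquiv.symm
        (permRep k κ t τ x))) = _
      rw [← h1, map_smul, asModuleEquiv_single_smul]
      rfl
    rw [← hT']
    clear hT'
    clear_value T'
    induction hspan using Submodule.span_induction with
    | mem S hS =>
      obtain ⟨g, rfl⟩ := hS
      exact Submodule.subset_span ⟨g, rfl⟩
    | zero => exact zero_mem _
    | add S S' _ _ h h' => exact add_mem h h'
    | smul c S _ h => exact Submodule.smul_mem _ c h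
  induction hx using Submodule.span_induction with
  | mem x hx =>
    obtain ⟨g, rfl⟩ := hx
    rw [← map_mulVecLin_asAlgebraHom]
    exact map_mem_orbitSpan g hy
  | zero => rw [map_zero]; exact zero_mem _
  | add x y _ _ hx hy => rw [map_add]; exact add_mem hx hy
  | smul a x _ hx => rw [map_smul]; exact Submodule.smul_mem _ _ hx

omit [Fintype κ] in
theorem asAlgebraHom_eq_self_of_mem_orbitSpan {u : κ → t → k}
    {a : MonoidAlgebra k (Equiv.Perm κ)} (ha : a • cyclicGen u = cyclicGen u)
    {x : ⨂[k] _ : κ, (t → k)} (hx : x ∈ orbitSpan u) :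
    (permRep k κ t).asAlgebraHom a x = x := by
  have h0 : (permRep k κ t).asAlgebraHom a (PiTensorProduct.tprod k u) =
      PiTensorProduct.tprod k u :=
    congrArg (fun y : cyclicMod u => (permRep k κ t).asModuleEquiv y.1) ha
  induction hx using Submodule.span_induction with
  | mem x hx =>
    obtain ⟨g, rfl⟩ := hx
    simp only
    rw [← map_mulVecLin_asAlgebraHom, h0]
  | zero => rw [map_zero]
  | add x y _ _ hx hy => rw [map_add, hx, hy]
  | smul a x _ hx => rw [map_smul, hx]

/-- Isomorphic cyclic modules over the symmetric group give isomorphic orbit spans over the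
general linear group. -/
theorem exists_orbitSpan_linearEquiv [CharZero k] [DecidableEq κ] {u u' : κ → t → k}
    (Θ : cyclicMod u ≃ₗ[MonoidAlgebra k (Equiv.Perm κ)] cyclicMod u') :
    ∃ Φ : orbitSpan u ≃ₗ[k] orbitSpan u', ∀ g : Matrix t t k, ∀ x y : orbitSpan u,
      y.1 = PiTensorProduct.map (fun _ => g.mulVecLin) x.1 →
        (Φ y).1 = PiTensorProduct.map (fun _ => g.mulVecLin) (Φ x).1 := by
  obtain ⟨a, ha, ha'⟩ := exists_asAlgebraHom_mapsTo_orbitSpan Θ.toLinearMap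
  obtain ⟨b, hb, hb'⟩ := exists_asAlgebraHom_mapsTo_orbitSpan Θ.symm.toLinearMap
  rw [LinearEquiv.coe_coe] at ha hb
  have hab : (a * b) • cyclicGen u = cyclicGen u := by
    rw [mul_smul, hb, ← map_smul, ha, LinearEquiv.symm_apply_apply]
  have hba : (b * a) • cyclicGen u' = cyclicGen u' := by
    rw [mul_smul, ha, ← map_smul, hb, LinearEquiv.apply_symm_apply]
  refine ⟨LinearEquiv.ofLinearMap (((permRep k κ t).asAlgebraHom b).restrict hb')
    (((permRep k κ t).asAlgebraHom a).restrict ha') ?_ ?_, fun g x y hxy => ?_⟩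
  · ext x
    have := asAlgebraHom_eq_self_of_mem_orbitSpan hba x.2
    rwa [map_mul] at this
  · ext x
    have := asAlgebraHom_eq_self_of_mem_orbitSpan hab x.2
    rwa [map_mul] at this
  · change (permRep k κ t).asAlgebraHom b y.1 = _
    rw [hxy, ← map_mulVecLin_asAlgebraHom]
    rfl

omit [DecidableEq t] [Fintype t] [Fintype κ] in
theorem cyclicMod_comp_le (u : κ → t → k) (τ : Equiv.Perm κ) :
    cyclicMod (u ∘ τ) ≤ cyclicMod u := by
  rw [cyclicMod, Submodule.span_singleton_le_iff_mem]
  have h : (permRep k κ t).asModuleEquiv.symm (PiTensorProduct.tprod k (u ∘ τ)) =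
      MonoidAlgebra.single τ.symm (1 : k) • (cyclicGen u).1 := by
    rw [LinearEquiv.symm_apply_eq, asModuleEquiv_single_smul, cyclicGen,
      LinearEquiv.apply_symm_apply, permRep_tprod]
    rfl
  rw [h]
  exact Submodule.smul_mem _ _ (cyclicGen u).2

omit [DecidableEq t] [Fintype t] [Fintype κ] in
theorem cyclicMod_comp (u : κ → t → k) (τ : Equiv.Perm κ) : cyclicMod (u ∘ τ) = cyclicMod u := by
  refine le_antisymm (cyclicMod_comp_le u τ) ?_
  have h := cyclicMod_comp_le (u ∘ τ) τ.symm
  rwa [Function.comp_assoc, Equiv.self_comp_symm, Function.comp_id] at h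

end Orbit

end SymmetricGroup

/-- If `v` and `w` have isomorphic matroids (via a permutation `σ` of the columns),
then the cyclic `GL_r(k)`-modules `G(v)` and `G(w)` are isomorphic as
`GL_r(k)`-modules. -/
theorem tensor_module_matroid_invariant
    {k : Type*} [Field k] [CharZero k] {r n : ℕ}
    (v w : Matrix (Fin r) (Fin n) k) (σ : Equiv.Perm (Fin n))
    (hM : ∀ S : Finset (Fin n),
      LinearIndependent k (fun j : S => fun i => v i (j : Fin n)) ↔
      LinearIndependent k (fun j : S => fun i => w i (σ (j : Fin n)))) :
    ∃ Φ : ↥(tensMod k v) ≃ₗ[k] ↥(tensMod k w),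
      ∀ g : (Matrix (Fin r) (Fin r) k)ˣ, ∀ x y : ↥(tensMod k v),
        y.1 = diagAct k g.1 x.1 → (Φ y).1 = diagAct k g.1 (Φ x).1 := by
  have hM' : ∀ S : Finset (Fin n), LinearIndepOn k (fun j i => v i j) (S : Set (Fin n)) ↔
      LinearIndepOn k ((fun j i => w i j) ∘ σ) (S : Set (Fin n)) := fun S => hM S
  obtain ⟨Θ⟩ := nonempty_cyclicMod_linearEquiv (k := k) (u := fun j i => v i j)
    (u' := (fun j i => w i j) ∘ σ) fun F => le_antisymm
      (finrank_span_image_le_of_linearIndepOn (fun S => (hM' S).1) F)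
      (finrank_span_image_le_of_linearIndepOn (fun S => (hM' S).2) F)
  have h : ∀ v : Matrix (Fin r) (Fin n) k, tensMod k v = orbitSpan fun j i => v i j := fun v => by
    rw [tensMod, orbitSpan]
    congr 1
    ext x
    exact exists_congr fun g => eq_comm
  rw [cyclicMod_comp] at Θ
  obtain ⟨Φ, hΦ⟩ := exists_orbitSpan_linearEquiv Θ
  rw [h v, h w]
  exact ⟨Φ, fun g => hΦ g.1⟩
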